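/- Let X ⊂ ℙ^r be an integral and non-degenerate projective variety of dimension n over an algebraically closed field of characteristic 0, weakly k-defective with dim σ_{k+n−1}(X) = (k+n−1)(n+1)−1 < r. Assume the general tangential k-contact locus Γ_k is irreducible (type I), and let Π_k = ⟨Γ_k⟩. Assume there exists an irreducible component W of Π_k ∩ X, different from Γ_k, such that Π_k is tangent to X along W. Then for all integers a > 0 and b ≥ 0 with a + b = k, the join of the a-th secant variety of W with the b-th secant variety of Γ_k cannot cover Π_k. -/

import Mathlib

noncomputable section

namespace ContactLoci

variable {K : Type*} [Field K] {ι : Type*} [Fintype ι]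

/-- Projective space over `K` with homogeneous coordinates indexed by `ι`. -/
abbrev PP (K : Type*) [Field K] (ι : Type*) : Type _ :=
  Projectivization K (ι → K)

/-- The affine cone over a set of projective points. -/
def coneOf (S : Set (PP K ι)) : Set (ι → K) :=
  ⋃ x ∈ S, (x.submodule : Set (ι → K))

/-- The linear span, in the underlying vector space, of the cone over `S`. -/
def vspan (S : Set (PP K ι)) : Submodule K (ι → K) :=
  Submodule.span K (coneOf S)

/-- The projective linear span of a set of projective points. -/
def projSpan (S : Set (PP K ι)) : Set (PP K ι) :=
  {x | x.submodule ≤ vspan S}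

/-- The projective dimension of the linear span of `S` (`-1` for `S = ∅`). -/
def projDim (S : Set (PP K ι)) : ℤ :=
  (Module.finrank K (vspan S) : ℤ) - 1

/-- A set of projective points is non-degenerate if its linear span is everything. -/
def Nondegenerate (S : Set (PP K ι)) : Prop :=
  vspan S = ⊤

/-- The common zero locus in projective space of a set of polynomials. -/
def zeroLocus (S : Set (MvPolynomial ι K)) : Set (PP K ι) :=
  {x | ∀ f ∈ S, ∀ v ∈ x.submodule, MvPolynomial.eval v f = 0}

/-- Zariski-closed subsets of projective space: common zero loci of sets of
homogeneous polynomials. -/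
def IsZClosed (X : Set (PP K ι)) : Prop :=
  ∃ S : Set (MvPolynomial ι K), (∀ f ∈ S, ∃ d : ℕ, f.IsHomogeneous d) ∧ X = zeroLocus S

/-- Zariski closure. -/
def zclosure (S : Set (PP K ι)) : Set (PP K ι) :=
  ⋂₀ {Y | IsZClosed Y ∧ S ⊆ Y}

/-- Irreducibility with respect to the Zariski topology. -/
def IsZIrreducible (S : Set (PP K ι)) : Prop :=
  S.Nonempty ∧ ∀ Y Z : Set (PP K ι), IsZClosed Y → IsZClosed Z → S ⊆ Y ∪ Z → S ⊆ Y ∨ S ⊆ Z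

/-- An integral projective variety: a Zariski-closed irreducible subset. -/
def IsIntegralVariety (X : Set (PP K ι)) : Prop :=
  IsZClosed X ∧ IsZIrreducible X

/-- `C` is an irreducible component of `S`: a maximal irreducible subset of `S`. -/
def IsZIrredComponent (S C : Set (PP K ι)) : Prop :=
  IsZIrreducible C ∧ C ⊆ S ∧ ∀ D : Set (PP K ι), IsZIrreducible D → D ⊆ S → C ⊆ D → C = D

/-- The dimension of a set: the Krull dimension of the poset of irreducible
Zariski-closed subsets of its Zariski closure (`⊥` for the empty set). -/
def zdim (S : Set (PP K ι)) : WithBot ℕ∞ :=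
  Order.krullDim ({Y : Set (PP K ι) // IsZClosed Y ∧ IsZIrreducible Y ∧ Y ⊆ zclosure S})

/-- A property holds at a general point of `X`: it holds away from a proper
Zariski-closed subset. -/
def HoldsGenerically (X : Set (PP K ι)) (P : PP K ι → Prop) : Prop :=
  ∃ Y : Set (PP K ι), IsZClosed Y ∧ ¬X ⊆ Y ∧ ∀ x ∈ X \ Y, P x

/-- Zero locus of multihomogeneous polynomials in a self-product of projective space. -/
def multiZeroLocus {m : ℕ} (S : Set (MvPolynomial (Fin m × ι) K)) :
    Set (Fin m → PP K ι) :=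
  {u | ∀ f ∈ S, ∀ v : Fin m → ι → K, (∀ i, v i ∈ (u i).submodule) →
    MvPolynomial.eval (fun p => v p.1 p.2) f = 0}

/-- Zariski-closed subsets of the `m`-fold self-product of projective space. -/
def IsMultiZClosed {m : ℕ} (T : Set (Fin m → PP K ι)) : Prop :=
  ∃ S : Set (MvPolynomial (Fin m × ι) K),
    (∀ f ∈ S, ∀ i : Fin m, ∃ d : ℕ,
      MvPolynomial.IsWeightedHomogeneous (fun p : Fin m × ι => if p.1 = i then 1 else 0) f d) ∧
    T = multiZeroLocus S

/-- A property holds for a general `m`-tuple of points of `X`. -/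
def HoldsForGeneralTuples (X : Set (PP K ι)) (m : ℕ) (P : (Fin m → PP K ι) → Prop) : Prop :=
  ∃ T : Set (Fin m → PP K ι), IsMultiZClosed T ∧
    (∃ u : Fin m → PP K ι, (∀ i, u i ∈ X) ∧ u ∉ T) ∧
    ∀ u : Fin m → PP K ι, (∀ i, u i ∈ X) → u ∉ T → P u

/-- The homogeneous vanishing ideal of `X` (as a set of homogeneous polynomials). -/
def homogVanishingIdeal (X : Set (PP K ι)) : Set (MvPolynomial ι K) :=
  {f | (∃ d : ℕ, f.IsHomogeneous d) ∧ ∀ x ∈ X, ∀ v ∈ x.submodule, MvPolynomial.eval v f = 0}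

/-- The embedded (projective) tangent space of `X` at `x`. -/
def embTangentSpace (X : Set (PP K ι)) (x : PP K ι) : Set (PP K ι) :=
  {y | ∀ f ∈ homogVanishingIdeal X,
    ∑ i : ι, y.rep i * MvPolynomial.eval x.rep (MvPolynomial.pderiv i f) = 0}

/-- Smooth points of `X`. -/
def IsSmoothPoint (X : Set (PP K ι)) (x : PP K ι) : Prop :=
  x ∈ X ∧ zdim (embTangentSpace X x) = zdim X

/-- `M_A`: the linear span of the tangent spaces of `X` at the points of `A`. -/
def tangentSpan (X A : Set (PP K ι)) : Set (PP K ι) :=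
  projSpan (⋃ a ∈ A, embTangentSpace X a)

/-- The locus of smooth points of `X` at which `M_A` is tangent to `X`. -/
def tangencyLocus (X A : Set (PP K ι)) : Set (PP K ι) :=
  {x | IsSmoothPoint X x ∧ embTangentSpace X x ⊆ tangentSpan X A}

/-- The tangential contact locus of `X` at `A`: the closure of the union of the
irreducible components of the tangency locus meeting `A`. -/
def contactLocus (X A : Set (PP K ι)) : Set (PP K ι) :=
  zclosure (⋃ C ∈ {C : Set (PP K ι) |
    IsZIrredComponent (tangencyLocus X A) C ∧ (C ∩ A).Nonempty}, C)

/-- `X` is weakly `k`-defective: the tangential contact locus at `k` general points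
has positive dimension. -/
def WeaklyDefective (X : Set (PP K ι)) (k : ℕ) : Prop :=
  HoldsForGeneralTuples X k fun u => 0 < zdim (contactLocus X (Set.range u))

/-- The `k`-th secant variety of `X`. -/
def secant (k : ℕ) (X : Set (PP K ι)) : Set (PP K ι) :=
  zclosure {q | ∃ S : Finset (PP K ι), ↑S ⊆ X ∧ S.card = k ∧ q ∈ projSpan (S : Set (PP K ι))}

/-- The `X`-rank of a point. -/
def xrank (X : Set (PP K ι)) (q : PP K ι) : ℕ :=
  sInf {k | ∃ S : Finset (PP K ι), ↑S ⊆ X ∧ S.card = k ∧ q ∈ projSpan (S : Set (PP K ι))}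

/-- `𝒮(q,X)`: the set of minimal `X`-decompositions of `q`. -/
def decompositions (X : Set (PP K ι)) (q : PP K ι) : Set (Finset (PP K ι)) :=
  {S | ↑S ⊆ X ∧ S.card = xrank X q ∧ q ∈ projSpan (S : Set (PP K ι))}

/-- `X` is `k`-identifiable: a general point of `σ_k(X)` has a unique minimal
decomposition. -/
def Identifiable (X : Set (PP K ι)) (k : ℕ) : Prop :=
  HoldsGenerically (secant k X) fun q => ∃! S : Finset (PP K ι), S ∈ decompositions X q

/-- `α` is the `k`-th secant degree of `X`. -/
def HasSecantDegree (X : Set (PP K ι)) (k α : ℕ) : Prop :=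
  HoldsGenerically (secant k X) fun q => (decompositions X q).ncard = α

/-- Projective linear subspaces. -/
def IsProjLinear (L : Set (PP K ι)) : Prop :=
  L = projSpan L

/-- Lines in projective space. -/
def IsLine (L : Set (PP K ι)) : Prop :=
  IsProjLinear L ∧ Module.finrank K (vspan L) = 2

/-- `X` is uniruled by lines: through a general point of `X` there is a line
contained in `X`. -/
def UniruledByLines (X : Set (PP K ι)) : Prop :=
  HoldsGenerically X fun x => ∃ L : Set (PP K ι), IsLine L ∧ x ∈ L ∧ L ⊆ X

/-- The join of two sets in projective space. -/
def join (A B : Set (PP K ι)) : Set (PP K ι) :=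
  zclosure (⋃ a ∈ A, ⋃ b ∈ B, projSpan {a, b})

/-- The linear space `M` is tangent to `X` along `W`. -/
def TangentAlong (M X W : Set (PP K ι)) : Prop :=
  ∀ x ∈ W, IsSmoothPoint X x → embTangentSpace X x ⊆ M

/-- `S` has exactly `m` irreducible components, all of them projective linear
subspaces, and these components are linearly independent. -/
def ComponentsAreIndepLinear (S : Set (PP K ι)) (m : ℕ) : Prop :=
  ∃ C : Fin m → Set (PP K ι), Function.Injective C ∧
    (∀ D : Set (PP K ι), IsZIrredComponent S D ↔ ∃ i, D = C i) ∧
    (∀ i, IsProjLinear (C i)) ∧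
    Module.finrank K (vspan S) = ∑ i, Module.finrank K (vspan (C i))


/-- The Segre variety: the image of `ℙ^{n 1} × ⋯ × ℙ^{n s}` under the Segre
embedding, given by the complete linear system `|O(1,…,1)|`. -/
def segreVariety (K : Type*) [Field K] (s : ℕ) (n : Fin s → ℕ) :
    Set (PP K (∀ i : Fin s, Fin (n i + 1))) :=
  {x | ∃ u : ∀ i : Fin s, Fin (n i + 1) → K,
    x.submodule = Submodule.span K
      ({fun t => ∏ i, u i (t i)} : Set ((∀ i : Fin s, Fin (n i + 1)) → K))}

/-- The projection of `L ⊆ Segre` to the `i`-th factor is a single point, i.e. `L`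
lies in a single fiber of the `i`-th projection. -/
def SegreFactorIsPoint (K : Type*) [Field K] (s : ℕ) (n : Fin s → ℕ) (i : Fin s)
    (L : Set (PP K (∀ j : Fin s, Fin (n j + 1)))) : Prop :=
  ∃ w : Fin (n i + 1) → K, w ≠ 0 ∧ ∀ x ∈ L,
    ∃ u : ∀ j : Fin s, Fin (n j + 1) → K,
      x.submodule = Submodule.span K
        ({fun t => ∏ j, u j (t j)} : Set ((∀ j : Fin s, Fin (n j + 1)) → K)) ∧
      u i ∈ Submodule.span K ({w} : Set (Fin (n i + 1) → K))

/-- Index type for the Segre–Veronese embedding of multidegree `d`: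
multi-indices of degree `d i` in the homogeneous variables of the `i`-th factor. -/
abbrev svIndex (s : ℕ) (n d : Fin s → ℕ) : Type :=
  ∀ i : Fin s, {w : Fin (n i + 1) → Fin (d i + 1) // ∑ j, (w j : ℕ) = d i}

/-- The Segre–Veronese variety of multidegree `d`: the image of
`ℙ^{n 1} × ⋯ × ℙ^{n s}` under the embedding by `|L_1^{d 1} ⊗ ⋯ ⊗ L_s^{d s}|`. -/
def segreVeroneseVariety (K : Type*) [Field K] (s : ℕ) (n d : Fin s → ℕ) :
    Set (PP K (svIndex s n d)) :=
  {x | ∃ u : ∀ i : Fin s, Fin (n i + 1) → K,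
    x.submodule = Submodule.span K
      ({fun t => ∏ i, ∏ j, u i j ^ ((t i).1 j : ℕ)} : Set (svIndex s n d → K))}

/-- The vector of the moments of degree `≤ d` of the one-dimensional Gaussian
distribution with mean `μ` and variance `t`. -/
def gaussMomentVec (K : Type*) [Field K] (d : ℕ) (μ t : K) : Fin (d + 1) → K := fun i =>
  ∑ j ∈ Finset.range ((i : ℕ) / 2 + 1),
    ((Nat.choose (i : ℕ) (2 * j) * Nat.doubleFactorial (2 * j - 1) : ℕ) : K) *
      t ^ j * μ ^ ((i : ℕ) - 2 * j)

/-- The Gaussian moment variety `𝒢_{1,d} ⊆ ℙ^d`. -/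
def gaussianMomentVariety (K : Type*) [Field K] (d : ℕ) : Set (PP K (Fin (d + 1))) :=
  zclosure {x | ∃ μ t : K,
    x.submodule = Submodule.span K ({gaussMomentVec K d μ t} : Set (Fin (d + 1) → K))}

/-- Zariski-closed families of `m`-tuples of coefficient vectors of linear forms. -/
def IsAffineClosedFamily {m : ℕ} (T : Set (Fin m → ι → K)) : Prop :=
  ∃ S : Set (MvPolynomial (Fin m × ι) K),
    T = {h | ∀ f ∈ S, MvPolynomial.eval (fun p => h p.1 p.2) f = 0}

/-- The linear subspace cut out by the `m` linear forms with coefficient vectors `h`. -/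
def linearSlice {m : ℕ} (h : Fin m → ι → K) : Set (PP K ι) :=
  {x | ∀ j : Fin m, ∑ i : ι, h j i * x.rep i = 0}

/-- `x` lies on the hyperplane with coefficient vector `f`. -/
def inHyperplane (f : ι → K) (x : PP K ι) : Prop :=
  ∑ i : ι, f i * x.rep i = 0

/-- `X ⊆ ℙ^r` (of dimension `n`, `r + 1 = card ι`) is very strange: for a general
codimension-`n` linear subspace `M`, some `r - n + 2` points of `X ∩ M` lie in a
hyperplane of `M`, i.e. in a linear subspace of projective dimension `r - n - 1`. -/
def VeryStrange (n : ℕ) (X : Set (PP K ι)) : Prop :=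
  ∃ T : Set (Fin n → ι → K), IsAffineClosedFamily T ∧ (∃ h, h ∉ T) ∧
    ∀ h : Fin n → ι → K, h ∉ T →
      ∃ A : Finset (PP K ι), ↑A ⊆ X ∩ linearSlice h ∧
        A.card = Fintype.card ι + 1 - n ∧
        Module.finrank K (vspan (A : Set (PP K ι))) ≤ Fintype.card ι - 1 - n


end ContactLoci

namespace ContactLoci
open MvPolynomial in
lemma coeff_block {K : Type*} [Field K] {σ B : Type*} [DecidableEq B]
    (π : σ → B) (f : MvPolynomial σ K) (v : σ → K) (d : B →₀ ℕ) :
    MvPolynomial.coeff d (MvPolynomial.aeval (fun s => (X (π s) * C (v s) : MvPolynomial B K)) f)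
      = MvPolynomial.eval v
        (MvPolynomial.weightedHomogeneousComponent (fun s => Finsupp.single (π s) 1) d f) := by
  classical
  induction f using MvPolynomial.induction_on' with
  | add p q hp hq => rw [map_add, MvPolynomial.coeff_add, hp, hq, map_add, map_add]
  | monomial u a =>
    have h1 : (MvPolynomial.aeval (fun s => (X (π s) * C (v s) : MvPolynomial B K))
        (monomial u a)) = monomial (Finsupp.weight (fun s => Finsupp.single (π s) 1) u)
          (eval v (monomial u a)) := by
      rw [aeval_monomial, eval_monomial]
      simp only [mul_pow, Finsupp.prod_mul, algebraMap_eq]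
      rw [Finsupp.weight_apply]
      have e1 : (u.prod fun i k => (C (v i) : MvPolynomial B K) ^ k)
          = C (u.prod fun i k => v i ^ k) := by
        simp [Finsupp.prod, map_prod]
      have e2 : (u.prod fun i k => (X (π i) : MvPolynomial B K) ^ k)
          = monomial (u.sum fun i c => c • Finsupp.single (π i) 1) 1 := by
        simp only [Finsupp.prod, Finsupp.sum, monomial_sum_one]
        refine Finset.prod_congr rfl fun i _ => ?_
        simp [X_pow_eq_monomial]
      rw [e1, e2, mul_comm (monomial _ _), ← mul_assoc, ← C_mul, C_mul_monomial, mul_one]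
    rw [h1, coeff_monomial]
    by_cases hd : Finsupp.weight (fun s => Finsupp.single (π s) 1) u = d
    · rw [if_pos hd, weightedHomogeneousComponent_of_mem
        (isWeightedHomogeneous_monomial _ _ _ hd : _ ∈ weightedHomogeneousSubmodule _ _ _),
        if_pos rfl]
    · rw [if_neg hd, weightedHomogeneousComponent_of_mem
        (isWeightedHomogeneous_monomial _ _ _ rfl : _ ∈ weightedHomogeneousSubmodule _ _ _),
        if_neg (fun h => hd h.symm), map_zero]

lemma comp_vanish {K : Type*} [Field K] [Infinite K] {σ B : Type*} 
    (π : σ → B) (f : MvPolynomial σ K) (v : σ → K)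
    (h : ∀ t : B → K, MvPolynomial.eval (fun s => t (π s) * v s) f = 0) (d : B →₀ ℕ) :
    MvPolynomial.eval v
      (MvPolynomial.weightedHomogeneousComponent (fun s => Finsupp.single (π s) 1) d f) = 0 := by
  classical
  rw [← coeff_block]
  have : (MvPolynomial.aeval (fun s => (MvPolynomial.X (π s) * MvPolynomial.C (v s) :
      MvPolynomial B K)) f) = 0 := by
    apply MvPolynomial.funext
    intro t
    rw [map_zero, ← h t, MvPolynomial.aeval_def, MvPolynomial.eval_eval₂, MvPolynomial.eval₂_eq_eval_map]
    simp only [map_mul, MvPolynomial.eval_X, MvPolynomial.eval_C, MvPolynomial.algebraMap_eq]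
    have : ((MvPolynomial.eval t).comp (MvPolynomial.C (R := K) (σ := B))) = RingHom.id K := by
      ext; simp
    rw [this, MvPolynomial.map_id]
  rw [this, MvPolynomial.coeff_zero]

lemma eval_eq_zero_of_comp {K : Type*} [Field K] {σ M : Type*} [AddCommMonoid M]
    (w : σ → M) (f : MvPolynomial σ K) (v : σ → K)
    (h : ∀ d, MvPolynomial.eval v (MvPolynomial.weightedHomogeneousComponent w d f) = 0) :
    MvPolynomial.eval v f = 0 := by
  rw [← MvPolynomial.sum_weightedHomogeneousComponent w f]
  rw [finsum_eq_sum _ (MvPolynomial.weightedHomogeneousComponent_finsupp f), map_sum]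
  exact Finset.sum_eq_zero fun d _ => h d

lemma weighted_of_block {K : Type*} [Field K] {σ B : Type*} [DecidableEq B]
    (π : σ → B) (f : MvPolynomial σ K) (d : B →₀ ℕ)
    (h : MvPolynomial.IsWeightedHomogeneous (fun s => Finsupp.single (π s) 1) f d) (b : B) :
    MvPolynomial.IsWeightedHomogeneous (fun s => if π s = b then 1 else 0) f (d b) := by
  intro u hu
  have := h hu
  rw [← this, Finsupp.weight_apply, Finsupp.weight_apply, Finsupp.sum, Finsupp.sum,
    Finsupp.finset_sum_apply]
  refine Finset.sum_congr rfl fun s _ => ?_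
  simp [Finsupp.single_apply]

variable {K : Type*} [Field K] {ι : Type*} [Fintype ι]

lemma isMultiZClosed_locus [Infinite K] {m : ℕ} (S : Set (MvPolynomial (Fin m × ι) K)) :
    IsMultiZClosed (multiZeroLocus S) := by
  let w : Fin m × ι → (Fin m →₀ ℕ) := fun s => Finsupp.single s.1 1
  refine ⟨{g | ∃ f ∈ S, ∃ d, g = MvPolynomial.weightedHomogeneousComponent w d f}, ?_, ?_⟩
  · rintro _ ⟨f, hf, d, rfl⟩ i
    exact ⟨d i, weighted_of_block (fun s : Fin m × ι => s.1) _ d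
      (MvPolynomial.weightedHomogeneousComponent_isWeightedHomogeneous d f) i⟩
  · ext u
    constructor
    · rintro hu _ ⟨f, hf, d, rfl⟩ v hv
      refine comp_vanish (fun s : Fin m × ι => s.1) f _ ?_ d
      intro t
      exact hu f hf (fun i => t i • v i) fun i => Submodule.smul_mem _ _ (hv i)
    · intro hu f hf v hv
      exact eval_eq_zero_of_comp w f _ fun d => hu _ ⟨f, hf, d, rfl⟩ v hv

lemma isZClosed_locus [Infinite K] (S : Set (MvPolynomial ι K)) :
    IsZClosed (zeroLocus S) := by
  classical
  let w : ι → (Unit →₀ ℕ) := fun s => Finsupp.single () 1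
  refine ⟨{g | ∃ f ∈ S, ∃ d, g = MvPolynomial.weightedHomogeneousComponent w d f}, ?_, ?_⟩
  · rintro _ ⟨f, hf, d, rfl⟩
    refine ⟨d (), ?_⟩
    have := weighted_of_block (fun _ : ι => ()) _ d
      (MvPolynomial.weightedHomogeneousComponent_isWeightedHomogeneous d f) ()
    simp only [if_true] at this
    exact this
  · ext x
    constructor
    · rintro hu _ ⟨f, hf, d, rfl⟩ v hv
      refine comp_vanish (fun _ : ι => ()) f _ ?_ d
      intro t
      exact hu f hf (t () • v) (Submodule.smul_mem _ _ hv)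
    · intro hu f hf v hv
      exact eval_eq_zero_of_comp w f _ fun d => hu _ ⟨f, hf, d, rfl⟩ v hv

lemma eval_smul_homog {f : MvPolynomial ι K} {d : ℕ} (hf : f.IsHomogeneous d) (c : K)
    (v : ι → K) : MvPolynomial.eval (c • v) f = c ^ d * MvPolynomial.eval v f := by
  rw [MvPolynomial.eval_eq, MvPolynomial.eval_eq, Finset.mul_sum]
  refine Finset.sum_congr rfl fun u hu => ?_
  have h1 := hf.degree_eq_sum_deg_support hu
  simp only [Pi.smul_apply, smul_eq_mul, mul_pow, Finset.prod_mul_distrib]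
  rw [Finset.prod_pow_eq_pow_sum, ← h1]
  ring

/-! ### basic facts -/

lemma rep_mem (x : PP K ι) : x.rep ∈ x.submodule := by
  rw [Projectivization.submodule_eq]; exact Submodule.mem_span_singleton_self _

lemma mem_submodule_iff {x : PP K ι} {v : ι → K} : v ∈ x.submodule ↔ ∃ c : K, c • x.rep = v := by
  rw [Projectivization.submodule_eq, Submodule.mem_span_singleton]

lemma submodule_le_iff {x : PP K ι} {L : Submodule K (ι → K)} :
    x.submodule ≤ L ↔ x.rep ∈ L := by
  rw [Projectivization.submodule_eq, Submodule.span_singleton_le_iff_mem]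

lemma eq_of_mem_submodule {x y : PP K ι} {v : ι → K} (hv : v ≠ 0) (hx : v ∈ x.submodule)
    (hy : v ∈ y.submodule) : x = y := by
  obtain ⟨c, rfl⟩ := mem_submodule_iff.1 hx
  obtain ⟨d, hd⟩ := mem_submodule_iff.1 hy
  have hc : c ≠ 0 := by rintro rfl; simp at hv
  have hd0 : d ≠ 0 := by rintro rfl; rw [zero_smul] at hd; exact hv hd.symm
  rw [← x.mk_rep, ← y.mk_rep, Projectivization.mk_eq_mk_iff']
  exact ⟨c⁻¹ * d, by rw [mul_smul, hd, smul_smul, inv_mul_cancel₀ hc, one_smul]⟩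

lemma mem_mk_submodule {v : ι → K} (hv : v ≠ 0) :
    v ∈ (Projectivization.mk K v hv : PP K ι).submodule := by
  rw [Projectivization.submodule_mk]; exact Submodule.mem_span_singleton_self _

lemma mem_coneOf {S : Set (PP K ι)} {v : ι → K} :
    v ∈ coneOf S ↔ ∃ x ∈ S, v ∈ x.submodule := by simp [coneOf]

lemma smul_mem_cone {S : Set (PP K ι)} {v : ι → K} (h : v ∈ coneOf S) (c : K) :
    c • v ∈ coneOf S := by
  obtain ⟨x, hx, hv⟩ := mem_coneOf.1 h
  exact mem_coneOf.2 ⟨x, hx, Submodule.smul_mem _ _ hv⟩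

/-- The vanishing ideal of the cone. -/
def IX (X : Set (PP K ι)) : Ideal (MvPolynomial ι K) := MvPolynomial.vanishingIdeal K (coneOf X)

lemma mem_IX {X : Set (PP K ι)} {f : MvPolynomial ι K} :
    f ∈ IX X ↔ ∀ x ∈ X, ∀ v ∈ x.submodule, MvPolynomial.eval v f = 0 := by
  simp only [IX, MvPolynomial.mem_vanishingIdeal_iff, MvPolynomial.coe_aeval_eq_eval,
    mem_coneOf]
  exact ⟨fun h x hx v hv => h v ⟨x, hx, hv⟩, fun h v ⟨x, hx, hv⟩ => h x hx v hv⟩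

lemma mem_IX' {X : Set (PP K ι)} {f : MvPolynomial ι K} :
    f ∈ IX X ↔ ∀ v ∈ coneOf X, MvPolynomial.eval v f = 0 := by
  simp only [IX, MvPolynomial.mem_vanishingIdeal_iff, MvPolynomial.coe_aeval_eq_eval]
  rfl

lemma subset_zeroLocus {X : Set (PP K ι)} {S : Set (MvPolynomial ι K)} :
    X ⊆ zeroLocus S ↔ S ⊆ IX X := by
  constructor
  · intro h f hf; exact mem_IX.2 fun x hx v hv => h hx f hf v hv
  · intro h x hx f hf v hv; exact mem_IX.1 (h hf) x hx v hv

lemma IX_anti {X Y : Set (PP K ι)} (h : X ⊆ Y) : IX Y ≤ IX X := by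
  intro f hf; rw [mem_IX] at *; exact fun x hx => hf x (h hx)

lemma closed_eq {X : Set (PP K ι)} (hX : IsZClosed X) : X = zeroLocus (IX X : Set _) := by
  apply Set.Subset.antisymm
  · rw [subset_zeroLocus]
  · obtain ⟨S, -, hS⟩ := hX
    intro x hx
    rw [hS]
    intro f hf v hv
    refine hx f ?_ v hv
    exact (subset_zeroLocus.1 hS.subset) hf

lemma IX_le_iff {X Y : Set (PP K ι)} (hY : IsZClosed Y) : IX Y ≤ IX X ↔ X ⊆ Y := by
  refine ⟨fun h => ?_, IX_anti⟩
  rw [closed_eq hY, subset_zeroLocus]; exact h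

lemma isZClosed_sInter [Infinite K] (C : Set (Set (PP K ι))) (h : ∀ Y ∈ C, IsZClosed Y) :
    IsZClosed (⋂₀ C) := by
  have : ⋂₀ C = zeroLocus (⋃ Y ∈ C, (IX Y : Set (MvPolynomial ι K))) := by
    ext x
    constructor
    · intro hx f hf v hv
      simp only [Set.mem_iUnion] at hf
      obtain ⟨Y, hY, hf⟩ := hf
      exact mem_IX.1 hf x (hx Y hY) v hv
    · intro hx Y hY
      rw [closed_eq (h Y hY)]
      intro f hf v hv
      exact hx f (by simp only [Set.mem_iUnion]; exact ⟨Y, hY, hf⟩) v hv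
  rw [this]; exact isZClosed_locus _

lemma isZClosed_inter [Infinite K] {Y Z : Set (PP K ι)} (hY : IsZClosed Y) (hZ : IsZClosed Z) :
    IsZClosed (Y ∩ Z) := by
  have := isZClosed_sInter {Y, Z} (by rintro W (rfl | rfl) <;> assumption)
  simpa using this

lemma isZClosed_zclosure [Infinite K] (S : Set (PP K ι)) : IsZClosed (zclosure S) :=
  isZClosed_sInter _ fun _ h => h.1

lemma subset_zclosure (S : Set (PP K ι)) : S ⊆ zclosure S :=
  Set.subset_sInter fun _ h => h.2

lemma zclosure_subset {S Y : Set (PP K ι)} (hY : IsZClosed Y) (h : S ⊆ Y) : zclosure S ⊆ Y :=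
  Set.sInter_subset_of_mem ⟨hY, h⟩

lemma zclosure_mono [Infinite K] {S T : Set (PP K ι)} (h : S ⊆ T) : zclosure S ⊆ zclosure T :=
  zclosure_subset (isZClosed_zclosure T) (h.trans (subset_zclosure T))

lemma zclosure_eq {S : Set (PP K ι)} (h : IsZClosed S) : zclosure S = S :=
  (zclosure_subset h le_rfl).antisymm (subset_zclosure S)

lemma mem_homog_locus {S : Set (MvPolynomial ι K)} (hS : ∀ f ∈ S, ∃ d : ℕ, f.IsHomogeneous d)
    {x : PP K ι} : x ∈ zeroLocus S ↔ ∀ f ∈ S, MvPolynomial.eval x.rep f = 0 := by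
  constructor
  · intro h f hf; exact h f hf _ (rep_mem x)
  · intro h f hf v hv
    obtain ⟨c, rfl⟩ := mem_submodule_iff.1 hv
    obtain ⟨d, hd⟩ := hS f hf
    rw [eval_smul_homog hd, h f hf, mul_zero]

lemma isZClosed_union {Y Z : Set (PP K ι)} (hY : IsZClosed Y) (hZ : IsZClosed Z) :
    IsZClosed (Y ∪ Z) := by
  obtain ⟨S, hS, rfl⟩ := hY
  obtain ⟨T, hT, rfl⟩ := hZ
  have hh : ∀ f ∈ {h | ∃ f ∈ S, ∃ g ∈ T, h = f * g}, ∃ d : ℕ, f.IsHomogeneous d := by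
    rintro _ ⟨f, hf, g, hg, rfl⟩
    obtain ⟨d, hd⟩ := hS f hf
    obtain ⟨e, he⟩ := hT g hg
    exact ⟨d + e, hd.mul he⟩
  refine ⟨_, hh, ?_⟩
  ext x
  rw [Set.mem_union, mem_homog_locus hS, mem_homog_locus hT, mem_homog_locus hh]
  constructor
  · rintro (h | h) _ ⟨f, hf, g, hg, rfl⟩
    · simp [h f hf]
    · simp [h g hg]
  · intro h
    by_contra hc
    push Not at hc
    obtain ⟨⟨f, hf, hf'⟩, g, hg, hg'⟩ := hc
    have := h _ ⟨f, hf, g, hg, rfl⟩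
    rw [map_mul] at this
    exact (mul_ne_zero hf' hg') this

lemma isZClosed_empty : IsZClosed (∅ : Set (PP K ι)) := by
  refine ⟨{1}, ?_, ?_⟩
  · rintro _ rfl; exact ⟨0, MvPolynomial.isHomogeneous_one _ _⟩
  · symm; rw [Set.eq_empty_iff_forall_notMem]
    intro x hx
    have := hx 1 rfl _ (rep_mem x)
    simp at this

lemma zclosure_irred {S : Set (PP K ι)} (h : IsZIrreducible S) : IsZIrreducible (zclosure S) := by
  refine ⟨h.1.mono (subset_zclosure S), fun Y Z hY hZ hs => ?_⟩
  rcases h.2 Y Z hY hZ ((subset_zclosure S).trans hs) with h | h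
  · exact Or.inl (zclosure_subset hY h)
  · exact Or.inr (zclosure_subset hZ h)

lemma exists_component {S D : Set (PP K ι)} (hD : IsZIrreducible D) (hDS : D ⊆ S) :
    ∃ C, IsZIrredComponent S C ∧ D ⊆ C := by
  obtain ⟨C, hDC, hC⟩ := zorn_subset_nonempty {E : Set (PP K ι) | IsZIrreducible E ∧ E ⊆ S}
    (by
      intro c hc hchain hne
      refine ⟨⋃₀ c, ⟨⟨?_, ?_⟩, Set.sUnion_subset fun E hE => (hc hE).2⟩,
        fun E hE => Set.subset_sUnion_of_mem hE⟩
      · obtain ⟨E, hE⟩ := hne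
        exact (hc hE).1.1.mono (Set.subset_sUnion_of_mem hE)
      · intro Y Z hY hZ hs
        by_contra hcon
        push Not at hcon
        obtain ⟨h1, h2⟩ := hcon
        rw [Set.sUnion_subset_iff] at h1 h2
        push Not at h1 h2
        obtain ⟨E, hE, hEY⟩ := h1
        obtain ⟨F, hF, hFZ⟩ := h2
        have : ∃ G ∈ c, E ⊆ G ∧ F ⊆ G := by
          rcases hchain.total hE hF with h | h
          · exact ⟨F, hF, h, le_rfl⟩
          · exact ⟨E, hE, le_rfl, h⟩
        obtain ⟨G, hG, hEG, hFG⟩ := this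
        rcases (hc hG).1.2 Y Z hY hZ ((Set.subset_sUnion_of_mem hG).trans hs) with h | h
        · exact hEY (hEG.trans h)
        · exact hFZ (hFG.trans h)) D ⟨hD, hDS⟩
  exact ⟨C, ⟨hC.prop.1, hC.prop.2, fun E hE hES hCE => hC.eq_of_subset ⟨hE, hES⟩ hCE⟩, hDC⟩

lemma component_closed [Infinite K] {S C : Set (PP K ι)} (hS : IsZClosed S)
    (hC : IsZIrredComponent S C) : IsZClosed C := by
  rw [hC.2.2 _ (zclosure_irred hC.1) (zclosure_subset hS hC.2.1) (subset_zclosure C)]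
  exact isZClosed_zclosure C

lemma eval_line_poly (F : MvPolynomial ι K) (v : ι → K) :
    ∃ p : Polynomial K, ∀ t, p.eval t = MvPolynomial.eval (t • v) F := by
  refine ⟨MvPolynomial.aeval (fun i => Polynomial.X * Polynomial.C (v i)) F, fun t => ?_⟩
  induction F using MvPolynomial.induction_on with
  | C a => simp
  | add p q hp hq => rw [map_add, Polynomial.eval_add, hp, hq, map_add]
  | mul_X p i hp => rw [map_mul, Polynomial.eval_mul, hp, map_mul]; simp; exact Or.inl (mul_comm _ _)

lemma IX_prime [Infinite K] {X : Set (PP K ι)} (hX : IsZIrreducible X) : (IX X).IsPrime := by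
  constructor
  · intro h
    obtain ⟨x, hx⟩ := hX.1
    have : (1 : MvPolynomial ι K) ∈ IX X := by rw [h]; trivial
    have := mem_IX.1 this x hx _ (rep_mem x)
    simp at this
  · intro F G hFG
    have : X ⊆ zeroLocus {F} ∪ zeroLocus {G} := by
      intro x hx
      obtain ⟨p, hp⟩ := eval_line_poly F x.rep
      obtain ⟨q, hq⟩ := eval_line_poly G x.rep
      have hpq : p * q = 0 := by
        apply Polynomial.funext
        intro t
        rw [Polynomial.eval_mul, hp, hq, ← map_mul, Polynomial.eval_zero]
        exact mem_IX.1 hFG x hx _ (Submodule.smul_mem _ _ (rep_mem x))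
      rcases mul_eq_zero.1 hpq with h | h
      · left; rintro _ rfl v hv
        obtain ⟨c, rfl⟩ := mem_submodule_iff.1 hv
        rw [← hp, h, Polynomial.eval_zero]
      · right; rintro _ rfl v hv
        obtain ⟨c, rfl⟩ := mem_submodule_iff.1 hv
        rw [← hq, h, Polynomial.eval_zero]
    rcases hX.2 _ _ (isZClosed_locus _) (isZClosed_locus _) this with h | h
    · left; exact subset_zeroLocus.1 h rfl
    · right; exact subset_zeroLocus.1 h rfl

lemma irred_of_prime [Infinite K] {X : Set (PP K ι)} (hne : X.Nonempty) (h : (IX X).IsPrime) :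
    IsZIrreducible X := by
  refine ⟨hne, fun Y Z hY hZ hs => ?_⟩
  rw [← IX_le_iff hY, ← IX_le_iff hZ]
  by_contra hc
  push Not at hc
  obtain ⟨h1, h2⟩ := hc
  obtain ⟨f, hf, hf'⟩ := SetLike.not_le_iff_exists.1 h1
  obtain ⟨g, hg, hg'⟩ := SetLike.not_le_iff_exists.1 h2
  have : f * g ∈ IX X := by
    rw [mem_IX]
    intro x hx v hv
    rw [map_mul]
    rcases hs hx with h | h
    · rw [mem_IX.1 hf x h v hv, zero_mul]
    · rw [mem_IX.1 hg x h v hv, mul_zero]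
  exact (h.mem_or_mem this).elim hf' hg'

/-- The projectivization of a linear subspace. -/
def PL (L : Submodule K (ι → K)) : Set (PP K ι) := {x | x.submodule ≤ L}

lemma cone_PL (L : Submodule K (ι → K)) : coneOf (PL L) ∪ {0} = (L : Set (ι → K)) := by
  ext v
  constructor
  · rintro (h | h)
    · obtain ⟨x, hx, hv⟩ := mem_coneOf.1 h
      exact hx hv
    · rw [h]; exact L.zero_mem
  · intro hv
    by_cases h0 : v = 0
    · right; exact h0
    · left
      refine mem_coneOf.2 ⟨Projectivization.mk K v h0, ?_, mem_mk_submodule h0⟩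
      change (Projectivization.mk K v h0).submodule ≤ L
      rw [Projectivization.submodule_mk, Submodule.span_singleton_le_iff_mem]; exact hv

lemma vspan_PL (L : Submodule K (ι → K)) : vspan (PL L) = L := by
  apply le_antisymm
  · rw [vspan, Submodule.span_le]
    intro v hv
    rw [← cone_PL L]; exact Or.inl hv
  · intro v hv
    have : v ∈ coneOf (PL L) ∪ {0} := by rw [cone_PL]; exact hv
    rcases this with h | h
    · exact Submodule.subset_span h
    · rw [h]; exact Submodule.zero_mem _

lemma isZClosed_PL [Infinite K] (L : Submodule K (ι → K)) : IsZClosed (PL L) := by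
  classical
  let pol : Module.Dual K (ι → K) → MvPolynomial ι K := fun φ =>
    ∑ i, MvPolynomial.C (φ (Pi.single i 1)) * MvPolynomial.X i
  have hpol : ∀ φ v, MvPolynomial.eval v (pol φ) = φ v := by
    intro φ v
    simp only [pol, map_sum, map_mul, MvPolynomial.eval_C, MvPolynomial.eval_X]
    rw [LinearMap.pi_apply_eq_sum_univ φ v]
    refine Finset.sum_congr rfl fun i _ => ?_
    rw [smul_eq_mul, mul_comm]; congr 2; ext j; simp [Pi.single_apply, eq_comm]
  have : PL L = zeroLocus (pol '' (L.dualAnnihilator : Set _)) := by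
    ext x
    constructor
    · rintro hx _ ⟨φ, hφ, rfl⟩ v hv
      rw [hpol]
      exact (Submodule.mem_dualAnnihilator φ).1 hφ v (hx hv)
    · intro hx v hv
      rw [← Subspace.dualAnnihilator_dualCoannihilator_eq (W := L), Submodule.mem_dualCoannihilator]
      intro φ hφ
      rw [← hpol]
      exact hx _ ⟨φ, hφ, rfl⟩ v hv
  rw [this]; exact isZClosed_locus _

lemma projSpan_eq_PL (S : Set (PP K ι)) : projSpan S = PL (vspan S) := rfl

lemma subset_projSpan (S : Set (PP K ι)) : S ⊆ projSpan S := fun x hx v hv =>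
  Submodule.subset_span (mem_coneOf.2 ⟨x, hx, hv⟩)

lemma vspan_mono {S T : Set (PP K ι)} (h : S ⊆ T) : vspan S ≤ vspan T :=
  Submodule.span_mono fun v hv => by
    obtain ⟨x, hx, hv⟩ := mem_coneOf.1 hv
    exact mem_coneOf.2 ⟨x, h hx, hv⟩

lemma PL_le_iff {L M : Submodule K (ι → K)} : PL L ⊆ PL M ↔ L ≤ M := by
  constructor
  · intro h
    rw [← vspan_PL L, ← vspan_PL M]; exact vspan_mono h
  · intro h x hx; exact le_trans hx h

lemma zclosure_subset_PL [Infinite K] {S : Set (PP K ι)} {L : Submodule K (ι → K)}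
    (h : S ⊆ PL L) : zclosure S ⊆ PL L := zclosure_subset (isZClosed_PL L) h

end ContactLoci

namespace ContactLoci

/-- natural transcendence degree -/
def td (K A : Type*) [Field K] [CommRing A] [Algebra K A] : ℕ := (Algebra.trdeg K A).toNat

section td
variable {K A B : Type*} [Field K] [CommRing A] [IsDomain A] [Algebra K A] [Algebra.FiniteType K A]
  [CommRing B] [IsDomain B] [Algebra K B] [Algebra.FiniteType K B]

lemma td_card {κ : Type*} [Fintype κ] {y : κ → A} (hy : IsTranscendenceBasis K y) :
    td K A = Fintype.card κ := by
  have h := hy.lift_cardinalMk_eq_trdeg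
  have := congrArg Cardinal.toNat h
  simp at this
  rw [td, ← this]

lemma le_td {κ : Type*} [Fintype κ] {y : κ → A} (hy : AlgebraicIndependent K y) :
    Fintype.card κ ≤ td K A := by
  have h := hy.lift_cardinalMk_le_trdeg
  have h2 : Algebra.trdeg K A < Cardinal.aleph0 :=
    trdeg_lt_aleph0_of_finiteType
  have := Cardinal.toNat_le_toNat h (by simpa using h2)
  simpa [td] using this

lemma td_basis (K A : Type*) [Field K] [CommRing A] [IsDomain A] [Algebra K A]
    [Algebra.FiniteType K A] : ∃ y : Fin (td K A) → A, IsTranscendenceBasis K y := by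
  obtain ⟨κ, y, hy⟩ := exists_isTranscendenceBasis' K A
  have h2 : Algebra.trdeg K A < Cardinal.aleph0 :=
    trdeg_lt_aleph0_of_finiteType
  have h := hy.lift_cardinalMk_eq_trdeg
  have : Finite κ := by
    rw [← Cardinal.lt_aleph0_iff_finite]
    simp only [Cardinal.lift_id] at h
    rw [h]; exact h2
  have := Fintype.ofFinite κ
  have e := (Fintype.equivFinOfCardEq (td_card hy).symm)
  exact ⟨y ∘ e.symm, hy.comp_equiv e.symm⟩

lemma basis_of_td {κ : Type*} [Fintype κ] {y : κ → A} (hy : AlgebraicIndependent K y)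
    (h : td K A ≤ Fintype.card κ) : IsTranscendenceBasis K y := by
  apply hy.isTranscendenceBasis_of_lift_trdeg_le_of_finite
  have h2 : Algebra.trdeg K A < Cardinal.aleph0 :=
    trdeg_lt_aleph0_of_finiteType
  rw [← Cardinal.cast_toNat_of_lt_aleph0 h2]
  simpa [td] using h

lemma td_surj (f : A →ₐ[K] B) (hf : Function.Surjective f) : td K B ≤ td K A := by
  obtain ⟨y, hy⟩ := td_basis K B
  choose g hg using hf
  have : AlgebraicIndependent K (f ∘ (g ∘ y)) := by
    have : f ∘ (g ∘ y) = y := by ext; simp [hg]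
    rw [this]; exact hy.1
  simpa using le_td (this.of_comp f)

lemma td_inj (f : A →ₐ[K] B) (hf : Function.Injective f) : td K A ≤ td K B := by
  obtain ⟨y, hy⟩ := td_basis K A
  simpa using le_td (hy.1.map' hf)

lemma td_le_ncard {s : Set A} (hs : s.Finite) (h : Algebra.IsAlgebraic (Algebra.adjoin K s) A) :
    td K A ≤ s.ncard := by
  have h1 := Algebra.IsAlgebraic.trdeg_le_cardinalMk (R := K) (A := A) s
  have : Finite s := hs
  have := Cardinal.toNat_le_toNat h1 (Cardinal.lt_aleph0_of_finite s)
  rw [← Nat.card_coe_set_eq]; exact this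

/-- strictness -/
lemma td_strict (f : A →ₐ[K] B) (hf : Function.Surjective f) (hn : ¬ Function.Injective f) :
    td K B < td K A := by
  refine lt_of_le_of_ne (td_surj f hf) fun heq => hn ?_
  obtain ⟨y, hy⟩ := td_basis K B
  choose g hg using hf
  have hfy : f ∘ (g ∘ y) = y := by ext; simp [hg]
  have h1 : AlgebraicIndependent K (f ∘ (g ∘ y)) := by
    rw [hfy]; exact hy.1
  have h2 : IsTranscendenceBasis K (g ∘ y) := basis_of_td (h1.of_comp f) (by simp [heq])
  have h3 := h2.isAlgebraic
  rw [injective_iff_map_eq_zero]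
  intro a ha
  by_contra ha0
  have h4 := Ideal.comap_ne_bot_of_algebraic_mem (R := Algebra.adjoin K (Set.range (g ∘ y)))
    (I := RingHom.ker f) ha0 ha (h3.isAlgebraic a)
  apply h4
  rw [eq_bot_iff]
  rintro ⟨b, hb⟩ hb'
  have hb2 : f b = 0 := hb'
  rw [Algebra.adjoin_range_eq_range_aeval] at hb
  obtain ⟨p, rfl⟩ := hb
  have : MvPolynomial.aeval (f ∘ (g ∘ y)) p = 0 := by
    rw [← hb2]; exact (MvPolynomial.comp_aeval_apply _ _ _).symm
  have := h1.eq_zero_of_aeval_eq_zero _ this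
  subst this
  apply Subtype.ext
  simp
end td
end ContactLoci

namespace ContactLoci

open MvPolynomial in
lemma slice_core {K A : Type*} [Field K] [Infinite K] [CommRing A] [IsDomain A] [Algebra K A]
    {ι : Type*} [Fintype ι] (x : ι → A) (hx : Algebra.adjoin K (Set.range x) = ⊤) (e : ℕ)
    (i : Fin (e + 2) → ι) (hy : IsTranscendenceBasis K (x ∘ i)) :
    ∃ Q : Ideal A, Q.IsPrime ∧ (∃ c : K, x (i 0) - algebraMap K A c * x (i 1) ∈ Q ∧
      x (i 0) - algebraMap K A c * x (i 1) ≠ 0) ∧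
      AlgebraicIndependent K (fun j : Fin (e + 1) => Ideal.Quotient.mk Q (x (i j.succ))) := by
  classical
  letI : Algebra (MvPolynomial (Fin (e + 2)) K) A := (MvPolynomial.aeval (x ∘ i) : (MvPolynomial (Fin (e + 2)) K) →ₐ[K] A).toRingHom.toAlgebra
  have hmap : ∀ p : (MvPolynomial (Fin (e + 2)) K), algebraMap (MvPolynomial (Fin (e + 2)) K) A p = MvPolynomial.aeval (x ∘ i) p := fun p => rfl
  haveI : IsScalarTower K (MvPolynomial (Fin (e + 2)) K) A := IsScalarTower.of_algebraMap_eq fun c => by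
    rw [hmap, MvPolynomial.algebraMap_eq, MvPolynomial.aeval_C]
  have hinj : Function.Injective (algebraMap (MvPolynomial (Fin (e + 2)) K) A) := hy.1
  haveI : Algebra.IsAlgebraic (MvPolynomial (Fin (e + 2)) K) A := by
    have h1 := hy.isAlgebraic
    constructor
    intro a
    have h2 := h1.isAlgebraic a
    obtain ⟨p, hp0, hp⟩ := h2
    have hr : ∀ b : Algebra.adjoin K (Set.range (x ∘ i)), ∃ q : (MvPolynomial (Fin (e + 2)) K), algebraMap (MvPolynomial (Fin (e + 2)) K) A q = b := by
      rintro ⟨b, hb⟩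
      rw [Algebra.adjoin_range_eq_range_aeval] at hb
      obtain ⟨q, rfl⟩ := hb
      exact ⟨q, rfl⟩
    let g := (algebraMap (MvPolynomial (Fin (e + 2)) K) A).codRestrict (Algebra.adjoin K (Set.range (x ∘ i))) (fun q => by
      rw [Algebra.adjoin_range_eq_range_aeval]; exact ⟨q, rfl⟩)
    have hg : Function.Surjective g := by
      intro b; obtain ⟨q, hq⟩ := hr b; exact ⟨q, Subtype.ext hq⟩
    obtain ⟨q, hq⟩ := Polynomial.map_surjective g hg p
    refine ⟨q, ?_, ?_⟩
    · rintro rfl; apply hp0; rw [← hq, Polynomial.map_zero]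
    · rw [← hq] at hp
      rw [← hp, Polynomial.aeval_def, Polynomial.aeval_def, Polynomial.eval₂_map]
      rfl
  have h1 : ∀ j : ι, ∃ f : (MvPolynomial (Fin (e + 2)) K), f ≠ 0 ∧ IsIntegral (MvPolynomial (Fin (e + 2)) K) (f • x j) := fun j =>
    (Algebra.IsAlgebraic.isAlgebraic (R := (MvPolynomial (Fin (e + 2)) K)) (x j)).exists_integral_multiple
  choose ff hff0 hff using h1
  let f : MvPolynomial (Fin (e + 2)) K := ∏ j, ff j
  have hf0 : f ≠ 0 := Finset.prod_ne_zero_iff.2 fun j _ => hff0 j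
  have hfx : ∀ j, IsIntegral (MvPolynomial (Fin (e + 2)) K) (f • x j) := by
    intro j
    have : f = (∏ l ∈ Finset.univ.erase j, ff l) * ff j :=
      (Finset.prod_erase_mul _ _ (Finset.mem_univ j)).symm
    rw [this, mul_smul]
    exact (hff j).smul _
  have hint : ∀ a : A, ∃ m : ℕ, IsIntegral (MvPolynomial (Fin (e + 2)) K) (f ^ m • a) := by
    intro a
    have ha : a ∈ Algebra.adjoin K (Set.range x) := by rw [hx]; trivial
    have up : ∀ (b : A) (m l : ℕ), IsIntegral (MvPolynomial (Fin (e + 2)) K) (f ^ m • b) → IsIntegral (MvPolynomial (Fin (e + 2)) K) (f ^ (l + m) • b) := by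
      intro b m l h
      rw [pow_add, mul_smul]; exact h.smul _
    induction ha using Algebra.adjoin_induction with
    | mem b hb => obtain ⟨j, rfl⟩ := hb; exact ⟨1, by rw [pow_one]; exact hfx j⟩
    | algebraMap r =>
      refine ⟨0, ?_⟩
      rw [pow_zero, one_smul, IsScalarTower.algebraMap_apply K (MvPolynomial (Fin (e + 2)) K) A]
      exact isIntegral_algebraMap
    | add b c _ _ hb hc =>
      obtain ⟨m, hm⟩ := hb
      obtain ⟨l, hl⟩ := hc
      refine ⟨l + m, ?_⟩
      rw [smul_add]
      exact (up _ _ _ hm).add (by have := up _ _ m hl; rwa [Nat.add_comm m l] at this)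
    | mul b c _ _ hb hc =>
      obtain ⟨m, hm⟩ := hb
      obtain ⟨l, hl⟩ := hc
      refine ⟨m + l, ?_⟩
      rw [pow_add, mul_smul_mul_comm]
      exact hm.mul hl
  obtain ⟨z, hz⟩ : ∃ z, MvPolynomial.eval z (f * X 1) ≠ 0 := by
    by_contra hc
    push Not at hc
    have : f * X 1 = 0 := MvPolynomial.funext fun z => by rw [hc z, map_zero]
    exact (mul_ne_zero hf0 (X_ne_zero 1)) this
  rw [map_mul, eval_X] at hz
  have hz1 : z 1 ≠ 0 := right_ne_zero_of_mul hz
  have hfz : MvPolynomial.eval z f ≠ 0 := left_ne_zero_of_mul hz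
  let c := z 0 / z 1
  let ψ : (MvPolynomial (Fin (e + 2)) K) →ₐ[K] (MvPolynomial (Fin (e + 2)) K) := MvPolynomial.aeval (fun j => if j = 0 then C c * X 1 else X j)
  have hψf : ψ f ≠ 0 := by
    intro h
    apply hfz
    have : MvPolynomial.eval z (ψ f) = MvPolynomial.eval z f := by
      have : ((MvPolynomial.aeval z : (MvPolynomial (Fin (e + 2)) K) →ₐ[K] K).comp ψ) = MvPolynomial.aeval z := by
        apply MvPolynomial.algHom_ext
        intro j
        by_cases hj : j = 0
        · subst hj; simp [ψ, c, hz1]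
        · simp [ψ, hj]
      have := congrArg (fun g : (MvPolynomial (Fin (e + 2)) K) →ₐ[K] K => g f) this
      exact this
    rw [← this, h, map_zero]
  let ℓ : MvPolynomial (Fin (e + 2)) K := X 0 - C c * X 1
  have hψℓ : ψ ℓ = 0 := by simp [ψ, ℓ]
  have hℓA : algebraMap (MvPolynomial (Fin (e + 2)) K) A ℓ = x (i 0) - algebraMap K A c * x (i 1) := by
    rw [hmap]; simp [ℓ]
  have hℓ0 : ℓ ≠ 0 := by
    intro h
    have h01 : (1 : Fin (e + 2)) ≠ 0 := by simp
    have := congrArg (MvPolynomial.eval (fun j => if j = 0 then (1 : K) else 0)) h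
    simp [ℓ, h01] at this
  haveI hkp : (RingHom.ker ψ).IsPrime := RingHom.ker_isPrime _
  let S : Submonoid A := ((RingHom.ker ψ).primeCompl).map (algebraMap (MvPolynomial (Fin (e + 2)) K) A)
  have hdis : Disjoint ((Ideal.span {algebraMap (MvPolynomial (Fin (e + 2)) K) A ℓ} : Ideal A) : Set A) (S : Set A) := by
    rw [Set.disjoint_left]
    intro a ha has
    obtain ⟨s, hs, rfl⟩ := has
    have hs' : ψ s ≠ 0 := hs
    obtain ⟨b, hb⟩ := Ideal.mem_span_singleton'.1 ha
    obtain ⟨m, p, hpm, hp⟩ := hint b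
    have hp' : Polynomial.aeval (f ^ m • b) p = 0 := hp
    have h2 := Polynomial.scaleRoots_aeval_eq_zero (r := ℓ) hp'
    have h3 : algebraMap (MvPolynomial (Fin (e + 2)) K) A ℓ * f ^ m • b = algebraMap (MvPolynomial (Fin (e + 2)) K) A (f ^ m * s) := by
      rw [map_mul, ← hb, Algebra.smul_def]; ring
    rw [h3, Polynomial.aeval_algebraMap_apply] at h2
    have h4 := hinj (h2.trans (map_zero _).symm)
    have h5 := congrArg ψ h4
    rw [map_zero, Polynomial.coe_aeval_eq_eval, ← Polynomial.eval₂_id,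
      ← AlgHom.coe_toRingHom, Polynomial.hom_eval₂, RingHom.comp_id, Polynomial.eval₂_eq_eval_map,
      Polynomial.map_scaleRoots _ _ _ (by rw [hpm.leadingCoeff]; simp)] at h5
    have h6 : ψ.toRingHom ℓ = 0 := hψℓ
    have h7 : (RingHomClass.toRingHom ψ) ℓ = 0 := hψℓ
    rw [h7, Polynomial.scaleRoots_zero, (hpm.map _).leadingCoeff, one_smul, Polynomial.eval_pow,
      Polynomial.eval_X] at h5
    have h8 := eq_zero_of_pow_eq_zero h5
    have h9 : ψ (f ^ m * s) = 0 := h8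
    rw [map_mul, map_pow] at h9
    exact mul_ne_zero (pow_ne_zero _ hψf) hs' h9
  obtain ⟨Q, hQ, hle, hQS⟩ := Ideal.exists_le_prime_disjoint _ _ hdis
  refine ⟨Q, hQ, ⟨c, ?_, ?_⟩, ?_⟩
  · rw [← hℓA]; exact hle (Ideal.subset_span rfl)
  · rw [← hℓA]; intro h; exact hℓ0 (hinj (h.trans (map_zero _).symm))
  · rw [algebraicIndependent_iff]
    intro p hp
    have h1 : algebraMap (MvPolynomial (Fin (e + 2)) K) A (rename Fin.succ p) ∈ Q := by
      rw [← Ideal.Quotient.eq_zero_iff_mem, ← hp, hmap, aeval_rename]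
      have := MvPolynomial.comp_aeval_apply (x ∘ i ∘ Fin.succ) (Ideal.Quotient.mkₐ K Q) p
      exact this
    have h2 : ψ (rename Fin.succ p) = 0 := by
      by_contra h
      exact Set.disjoint_left.1 hQS h1 ⟨_, h, rfl⟩
    have h3 : ψ (rename Fin.succ p) = rename Fin.succ p := by
      simp only [ψ]
      rw [aeval_rename, rename_eq_aeval] 
      congr 2
    rw [h3] at h2
    exact rename_injective _ (Fin.succ_injective _) (h2.trans (map_zero _).symm)

end ContactLoci

namespace ContactLoci

/-- transcendence degree of the quotient ring -/
def tI {K σ : Type*} [Field K] (P : Ideal (MvPolynomial σ K)) : ℕ := td K (MvPolynomial σ K ⧸ P)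

section
variable {K σ : Type*} [Field K] [Finite σ]

lemma tI_anti {P Q : Ideal (MvPolynomial σ K)} [P.IsPrime] [Q.IsPrime] (h : P ≤ Q) :
    tI Q ≤ tI P :=
  td_surj (Ideal.Quotient.factorₐ K h) (Ideal.Quotient.factor_surjective h)

lemma tI_strict {P Q : Ideal (MvPolynomial σ K)} [P.IsPrime] [Q.IsPrime] (h : P < Q) :
    tI Q < tI P := by
  refine td_strict (Ideal.Quotient.factorₐ K h.le) (Ideal.Quotient.factor_surjective h.le) ?_
  intro hinj
  obtain ⟨f, hf, hfP⟩ := SetLike.exists_of_lt h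
  apply hfP
  rw [← Ideal.Quotient.eq_zero_iff_mem]
  apply hinj
  rw [map_zero]
  exact Ideal.Quotient.eq_zero_iff_mem.2 hf

lemma tI_comap {τ : Type*} [Finite τ] (φ : MvPolynomial τ K →ₐ[K] MvPolynomial σ K)
    (P : Ideal (MvPolynomial σ K)) [P.IsPrime] : tI (P.comap φ) ≤ tI P := by
  refine td_inj (Ideal.quotientMapₐ P φ le_rfl) (Ideal.quotientMap_injective)

end

variable {K : Type*} [Field K] {ι : Type*} [Fintype ι]

lemma zero_mem_cone {X : Set (PP K ι)} (h : X.Nonempty) : (0 : ι → K) ∈ coneOf X := by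
  obtain ⟨x, hx⟩ := h
  exact mem_coneOf.2 ⟨x, hx, Submodule.zero_mem _⟩

lemma exists_coord (x : PP K ι) : ∃ i, x.rep i ≠ 0 := by
  by_contra h
  push Not at h
  exact x.rep_nonzero (funext h)

lemma one_le_tI [Infinite K] {Y : Set (PP K ι)} (hY : IsZIrreducible Y) : 1 ≤ tI (IX Y) := by
  haveI := IX_prime hY
  let M := RingHom.ker (MvPolynomial.eval (0 : ι → K))
  haveI : M.IsPrime := RingHom.ker_isPrime _
  have : IX Y < M := by
    rw [SetLike.lt_iff_le_and_exists]
    refine ⟨fun f hf => mem_IX'.1 hf 0 (zero_mem_cone hY.1), ?_⟩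
    obtain ⟨x, hx⟩ := hY.1
    obtain ⟨i, hi⟩ := exists_coord x
    refine ⟨MvPolynomial.X i, by simp [M], fun h => hi ?_⟩
    simpa using mem_IX.1 h x hx _ (rep_mem x)
  have := tI_strict this
  omega

lemma zdim_le [Infinite K] {S : Set (PP K ι)} (q : Ideal (MvPolynomial ι K)) [q.IsPrime]
    (hS : S ⊆ zeroLocus (q : Set _)) (D : ℕ) (hD : tI q ≤ D + 1) :
    zdim S ≤ ((D : ℕ∞) : WithBot ℕ∞) := by
  unfold zdim Order.krullDim
  refine iSup_le fun p => ?_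
  have hsm : StrictMono fun Y : {Y : Set (PP K ι) // IsZClosed Y ∧ IsZIrreducible Y ∧
      Y ⊆ zclosure S} => tI (IX Y.1) := by
    rintro ⟨Y, hY⟩ ⟨Z, hZ⟩ hlt
    haveI := IX_prime hY.2.1
    haveI := IX_prime hZ.2.1
    apply tI_strict
    have hlt' : Y ⊂ Z := hlt
    refine lt_of_le_not_ge (IX_anti hlt'.1) fun h => hlt'.2 ?_
    exact (IX_le_iff hY.1).1 h
  have h1 := LTSeries.head_add_length_le_nat (p.map _ hsm)
  rw [LTSeries.head_map, LTSeries.last_map] at h1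
  have h2 : 1 ≤ tI (IX p.head.1) := one_le_tI p.head.2.2.1
  have h3 : tI (IX p.last.1) ≤ tI q := by
    haveI := IX_prime p.last.2.2.1
    apply tI_anti
    have : zclosure S ⊆ zeroLocus (q : Set _) := zclosure_subset (isZClosed_locus _) hS
    exact subset_zeroLocus.1 (p.last.2.2.2.trans this)
  have h4 : (p.map _ hsm).length = p.length := rfl
  have : p.length ≤ D := by omega
  exact_mod_cast this

lemma comp_eval_zero [Infinite K] {f : MvPolynomial ι K} {v : ι → K}
    (h : ∀ t : K, MvPolynomial.eval (t • v) f = 0) (n : ℕ) :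
    MvPolynomial.eval v (MvPolynomial.homogeneousComponent n f) = 0 := by
  by_cases hn : n ∈ Finset.range (f.totalDegree + 1)
  · let p : Polynomial K := ∑ m ∈ Finset.range (f.totalDegree + 1),
      Polynomial.monomial m (MvPolynomial.eval v (MvPolynomial.homogeneousComponent m f))
    have hp : p = 0 := by
      apply Polynomial.funext
      intro t
      rw [Polynomial.eval_zero, ← h t]
      conv_rhs => rw [← MvPolynomial.sum_homogeneousComponent f]
      rw [map_sum, Polynomial.eval_finset_sum]
      refine Finset.sum_congr rfl fun m _ => ?_
      rw [eval_smul_homog (MvPolynomial.homogeneousComponent_isHomogeneous m f),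
        Polynomial.eval_monomial, mul_comm]
    have := congrArg (fun q => Polynomial.coeff q n) hp
    simp only [p, Polynomial.finset_sum_coeff, Polynomial.coeff_monomial, Polynomial.coeff_zero,
      Finset.sum_ite_eq', hn, if_true] at this
    exact this
  · rw [MvPolynomial.homogeneousComponent_eq_zero _ _ (by simpa using hn), map_zero]

lemma IX_homog [Infinite K] {X : Set (PP K ι)} {f : MvPolynomial ι K} (hf : f ∈ IX X) (n : ℕ) :
    MvPolynomial.homogeneousComponent n f ∈ IX X := by
  rw [mem_IX'] at *
  intro v hv
  exact comp_eval_zero (fun t => hf _ (smul_mem_cone hv t)) n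

lemma mem_of_comps {P : Ideal (MvPolynomial ι K)} {f : MvPolynomial ι K}
    (h : ∀ n, MvPolynomial.homogeneousComponent n f ∈ P) : f ∈ P := by
  rw [← MvPolynomial.sum_homogeneousComponent f]
  exact Ideal.sum_mem _ fun n _ => h n

/-- projective Nullstellensatz for homogeneous primes -/
lemma IX_zeroLocus [IsAlgClosed K] (P : Ideal (MvPolynomial ι K)) [hP : P.IsPrime]
    (hh : ∀ f ∈ P, ∀ n, MvPolynomial.homogeneousComponent n f ∈ P) (i : ι)
    (hi : MvPolynomial.X i ∉ P) :
    IX (zeroLocus (P : Set (MvPolynomial ι K))) = P ∧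
      (zeroLocus (P : Set (MvPolynomial ι K))).Nonempty := by
  have key : ∀ v ∈ MvPolynomial.zeroLocus K P, ∀ hv : v ≠ 0,
      (Projectivization.mk K v hv : PP K ι) ∈ zeroLocus (P : Set (MvPolynomial ι K)) := by
    intro v hv hv0 f hf w hw
    rw [Projectivization.submodule_mk, Submodule.mem_span_singleton] at hw
    obtain ⟨c, rfl⟩ := hw
    rw [← MvPolynomial.sum_homogeneousComponent f, map_sum]
    refine Finset.sum_eq_zero fun n _ => ?_
    rw [eval_smul_homog (MvPolynomial.homogeneousComponent_isHomogeneous n f)]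
    have : MvPolynomial.eval v (MvPolynomial.homogeneousComponent n f) = 0 := hv _ (hh f hf n)
    rw [this, mul_zero]
  have hne : (zeroLocus (P : Set (MvPolynomial ι K))).Nonempty := by
    by_contra hc
    apply hi
    rw [← hP.radical, ← MvPolynomial.vanishingIdeal_zeroLocus_eq_radical (K := K)]
    rw [MvPolynomial.mem_vanishingIdeal_iff]
    intro v hv
    by_cases hv0 : v = 0
    · subst hv0; simp
    · exact (hc ⟨_, key v hv hv0⟩).elim
  refine ⟨le_antisymm ?_ ?_, hne⟩
  · intro f hf
    rw [← hP.radical, ← MvPolynomial.vanishingIdeal_zeroLocus_eq_radical (K := K)]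
    rw [MvPolynomial.mem_vanishingIdeal_iff]
    intro v hv
    rw [mem_IX'] at hf
    by_cases hv0 : v = 0
    · subst hv0; exact hf 0 (zero_mem_cone hne)
    · exact hf v (mem_coneOf.2 ⟨_, key v hv hv0, mem_mk_submodule hv0⟩)
  · exact subset_zeroLocus.1 le_rfl

open MvPolynomial in
lemma slice [IsAlgClosed K] {X : Set (PP K ι)} (hX : IsIntegralVariety X) (d : ℕ)
    (hd : d + 2 ≤ tI (IX X)) : ∃ X', IsIntegralVariety X' ∧ X' ⊂ X ∧ d + 1 ≤ tI (IX X') := by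
  classical
  haveI := IsAlgClosed.instInfinite (K := K)
  haveI hp := IX_prime hX.2
  let A := MvPolynomial ι K ⧸ IX X
  let x : ι → A := fun i => Ideal.Quotient.mk _ (MvPolynomial.X i)
  have hx : Algebra.adjoin K (Set.range x) = ⊤ := by
    rw [Algebra.adjoin_range_eq_range_aeval, AlgHom.range_eq_top]
    intro a
    obtain ⟨f, rfl⟩ := Ideal.Quotient.mk_surjective a
    refine ⟨f, ?_⟩
    have := MvPolynomial.comp_aeval_apply MvPolynomial.X (Ideal.Quotient.mkₐ K (IX X)) f
    rw [MvPolynomial.aeval_X_left_apply] at this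
    exact this.symm
  haveI : Algebra.IsAlgebraic (Algebra.adjoin K (Set.range x)) A := by
    rw [hx]
    constructor
    intro a
    exact isAlgebraic_algebraMap (⟨a, trivial⟩ : (⊤ : Subalgebra K A))
  obtain ⟨s, hs, hb⟩ := exists_isTranscendenceBasis_subset (R := K) (Set.range x)
  haveI : Finite s := (Set.finite_range x).subset hs
  haveI := Fintype.ofFinite s
  have hcard : tI (IX X) = Fintype.card s := td_card hb
  obtain ⟨e, he⟩ : ∃ e, tI (IX X) = e + 2 := ⟨tI (IX X) - 2, by omega⟩
  let eq : Fin (e + 2) ≃ s := (Fintype.equivFinOfCardEq (hcard.symm.trans he)).symm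
  have hch : ∀ j, ∃ i, x i = eq j := fun j => hs (eq j).2
  choose i hi using hch
  have hy : IsTranscendenceBasis K (x ∘ i) := by
    have : x ∘ i = Subtype.val ∘ eq := by ext j; exact hi j
    rw [this]; exact hb.comp_equiv eq
  obtain ⟨Q, hQ, ⟨c, hcQ, hc0⟩, hind⟩ := slice_core x hx e i hy
  letI := MvPolynomial.gradedAlgebra (σ := ι) (R := K)
  let P : Ideal (MvPolynomial ι K) := Q.comap (Ideal.Quotient.mk (IX X))
  haveI hP : P.IsPrime := Ideal.IsPrime.comap _
  let P' := (P.homogeneousCore (MvPolynomial.homogeneousSubmodule ι K)).toIdeal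
  haveI hP' : P'.IsPrime := hP.homogeneousCore
  have hP'P : P' ≤ P := Ideal.toIdeal_homogeneousCore_le _ _
  have hmem : ∀ f n, f.IsHomogeneous n → f ∈ P → f ∈ P' := by
    intro f n hf hfP
    exact Ideal.mem_homogeneousCore_of_homogeneous_of_mem ⟨n, hf⟩ hfP
  have hhom : ∀ f ∈ P', ∀ n, MvPolynomial.homogeneousComponent n f ∈ P' := by
    intro f hf n
    have := (P.homogeneousCore (MvPolynomial.homogeneousSubmodule ι K)).isHomogeneous n hf
    rw [← MvPolynomial.decomposition.decompose'_apply]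
    exact this
  have hIP : IX X ≤ P' := by
    intro f hf
    apply mem_of_comps
    intro n
    refine hmem _ n (MvPolynomial.homogeneousComponent_isHomogeneous n f) ?_
    change Ideal.Quotient.mk (IX X) _ ∈ Q
    rw [Ideal.Quotient.eq_zero_iff_mem.2 (IX_homog hf n)]
    exact Q.zero_mem
  have hℓ : (MvPolynomial.X (i 0) - C c * MvPolynomial.X (i 1) : MvPolynomial ι K) ∈ P' := by
    refine hmem _ 1 ?_ ?_
    · exact (isHomogeneous_X K (i 0)).sub (by
        simpa using (isHomogeneous_C ι c).mul (isHomogeneous_X K (i 1)))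
    · exact hcQ
  have hℓ' : (MvPolynomial.X (i 0) - C c * MvPolynomial.X (i 1) : MvPolynomial ι K) ∉ IX X := by
    intro h; apply hc0; exact Ideal.Quotient.eq_zero_iff_mem.2 h
  have hlift : ∀ f ∈ P', ((Ideal.Quotient.mkₐ K Q).comp (Ideal.Quotient.mkₐ K (IX X))) f = 0 := by
    intro f hf
    exact Ideal.Quotient.eq_zero_iff_mem.2 (hP'P hf)
  let g := Ideal.Quotient.liftₐ P' _ hlift
  have hind' : AlgebraicIndependent K (g ∘ fun j : Fin (e + 1) => Ideal.Quotient.mk P' (MvPolynomial.X (i j.succ))) :=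
    hind
  have hind2 := hind'.of_comp g
  have hcard2 : e + 1 ≤ tI P' := by simpa [tI] using le_td hind2
  have hXP : (MvPolynomial.X (i (Fin.succ 0)) : MvPolynomial ι K) ∉ P' := by
    intro h
    exact hind2.ne_zero 0 (Ideal.Quotient.eq_zero_iff_mem.2 h)
  obtain ⟨h1, h2⟩ := IX_zeroLocus P' hhom _ hXP
  refine ⟨zeroLocus (P' : Set _), ⟨isZClosed_locus _, irred_of_prime h2 (by rw [h1]; exact hP')⟩,
    ?_, by rw [h1]; omega⟩
  have hsub : zeroLocus (P' : Set (MvPolynomial ι K)) ⊆ X := (IX_le_iff hX.1).1 (by rw [h1]; exact hIP)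
  refine ⟨hsub, fun h => hℓ' ?_⟩
  exact IX_anti h (by rw [h1]; exact hℓ)

lemma le_zdim [IsAlgClosed K] (d : ℕ) : ∀ {X : Set (PP K ι)} (hX : IsIntegralVariety X)
    (hd : d + 1 ≤ tI (IX X)), ((d : ℕ∞) : WithBot ℕ∞) ≤ zdim X := by
  haveI := IsAlgClosed.instInfinite (K := K)
  induction d with
  | zero =>
    intro X hX _
    have := (Order.le_krullDim_iff (α := {Y : Set (PP K ι) // IsZClosed Y ∧ IsZIrreducible Y ∧
      Y ⊆ zclosure X}) (n := 0)).2 ⟨RelSeries.singleton _ ⟨X, hX.1, hX.2, subset_zclosure X⟩, rfl⟩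
    exact this
  | succ d ih =>
    intro X hX hd
    obtain ⟨X', hX', hlt, hd'⟩ := slice hX d hd
    have h1 := ih hX' hd'
    obtain ⟨p, hp⟩ := Order.le_krullDim_iff.1 h1
    have hcl : zclosure X' ⊂ X := by rw [zclosure_eq hX'.1]; exact hlt
    let F : {Y : Set (PP K ι) // IsZClosed Y ∧ IsZIrreducible Y ∧ Y ⊆ zclosure X'} →
      {Y : Set (PP K ι) // IsZClosed Y ∧ IsZIrreducible Y ∧ Y ⊆ zclosure X} := fun Y =>
        ⟨Y.1, Y.2.1, Y.2.2.1, Y.2.2.2.trans (hcl.1.trans (subset_zclosure X))⟩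
    have hF : StrictMono F := fun Y Z h => h
    have := (Order.le_krullDim_iff (α := {Y : Set (PP K ι) // IsZClosed Y ∧ IsZIrreducible Y ∧
      Y ⊆ zclosure X}) (n := d + 1)).2 ⟨(p.map F hF).snoc ⟨X, hX.1, hX.2, subset_zclosure X⟩ (by
        rw [LTSeries.last_map]
        have : p.last.1 ⊂ X := lt_of_le_of_lt p.last.2.2.2 hcl
        exact this), by
          simp [hp]⟩
    exact this

lemma tI_of_zdim [IsAlgClosed K] {X : Set (PP K ι)} (hX : IsIntegralVariety X) {n : ℕ}
    (h : zdim X = ((n : ℕ∞) : WithBot ℕ∞)) : tI (IX X) = n + 1 := by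
  haveI := IsAlgClosed.instInfinite (K := K)
  haveI := IX_prime hX.2
  apply le_antisymm
  · by_contra hc
    have := le_zdim (n + 1) hX (by omega)
    rw [h] at this
    have h3 : n + 1 ≤ n := by exact_mod_cast this
    omega
  · by_contra hc
    have h1 := one_le_tI hX.2
    obtain ⟨m, hm⟩ : ∃ m, tI (IX X) = m + 1 := ⟨tI (IX X) - 1, by omega⟩
    have := zdim_le (S := X) (IX X) (closed_eq hX.1).subset m hm.le
    rw [h] at this
    have h3 : n ≤ m := by exact_mod_cast this
    omega

end ContactLoci

namespace ContactLoci
variable {K : Type*} [Field K] {ι : Type*} [Fintype ι]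

lemma PL_nonempty {L : Submodule K (ι → K)} (h : L ≠ ⊥) : (PL L).Nonempty := by
  obtain ⟨v, hv, hv0⟩ := Submodule.exists_mem_ne_zero_of_ne_bot h
  have : v ∈ coneOf (PL L) ∪ {0} := by rw [cone_PL]; exact hv
  rcases this with h | h
  · obtain ⟨x, hx, _⟩ := mem_coneOf.1 h; exact ⟨x, hx⟩
  · exact (hv0 h).elim

lemma tI_PL [Infinite K] (L : Submodule K (ι → K)) (hL : L ≠ ⊥) :
    (IX (PL L)).IsPrime ∧ tI (IX (PL L)) = Module.finrank K L := by
  classical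
  let m := Module.finrank K L
  let b : Module.Basis (Fin m) K L := Module.finBasis K L
  let φ : MvPolynomial ι K →ₐ[K] MvPolynomial (Fin m) K :=
    MvPolynomial.aeval fun i => ∑ j, MvPolynomial.C ((b j : ι → K) i) * MvPolynomial.X j
  have hφ : ∀ (t : Fin m → K) (f : MvPolynomial ι K), MvPolynomial.eval t (φ f) =
      MvPolynomial.eval (∑ j, t j • (b j : ι → K)) f := by
    intro t f
    have : ((MvPolynomial.aeval t : MvPolynomial (Fin m) K →ₐ[K] K).comp φ) =
        MvPolynomial.aeval (∑ j, t j • (b j : ι → K)) := by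
      apply MvPolynomial.algHom_ext
      intro i
      rw [AlgHom.comp_apply, MvPolynomial.aeval_X, MvPolynomial.aeval_X, map_sum,
        Finset.sum_apply]
      refine Finset.sum_congr rfl fun j _ => ?_
      rw [map_mul, MvPolynomial.aeval_X, MvPolynomial.aeval_C]
      simp [mul_comm]
    exact congrArg (fun g : MvPolynomial ι K →ₐ[K] K => g f) this
  have hker : IX (PL L) = RingHom.ker φ := by
    ext f
    rw [mem_IX', RingHom.mem_ker]
    constructor
    · intro h
      apply MvPolynomial.funext
      intro t
      rw [map_zero, hφ]
      have hm : (∑ j, t j • (b j : ι → K)) ∈ L :=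
        Submodule.sum_mem _ fun j _ => Submodule.smul_mem _ _ (b j).2
      have : (∑ j, t j • (b j : ι → K)) ∈ coneOf (PL L) ∪ {0} := by rw [cone_PL]; exact hm
      rcases this with h' | h'
      · exact h _ h'
      · rw [h']; exact h 0 (zero_mem_cone (PL_nonempty hL))
    · intro h v hv
      have hvL : v ∈ L := by rw [← SetLike.mem_coe, ← cone_PL]; exact Or.inl hv
      have := hφ (b.repr ⟨v, hvL⟩) f
      have h2 : (∑ j, b.repr ⟨v, hvL⟩ j • (b j : ι → K)) = v := by
        have := congrArg L.subtype (b.sum_repr ⟨v, hvL⟩)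
        rw [map_sum] at this
        exact this
      rw [h2, h, map_zero] at this
      exact this.symm
  obtain ⟨g, hg⟩ := LinearMap.exists_leftInverse_of_injective L.subtype (by simp)
  have hsurj : Function.Surjective φ := by
    rw [← AlgHom.range_eq_top, eq_top_iff, ← MvPolynomial.adjoin_range_X, Algebra.adjoin_le_iff]
    rintro _ ⟨j, rfl⟩
    refine ⟨∑ i, MvPolynomial.C (b.repr (g (Pi.single i 1)) j) * MvPolynomial.X i, ?_⟩
    change φ _ = _
    apply MvPolynomial.funext
    intro t
    rw [hφ, map_sum, MvPolynomial.eval_X]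
    let v := ∑ l, t l • (b l : ι → K)
    have h1 : b.repr (g v) j = t j := by
      have : g v = ∑ l, t l • b l := by
        simp only [v, map_sum, map_smul]
        refine Finset.sum_congr rfl fun l _ => ?_
        congr 1
        exact congrArg (fun h : L →ₗ[K] L => h (b l)) hg
      rw [this, b.repr_sum_self]
    have h2 : b.repr (g v) j = ∑ i, v i * b.repr (g (Pi.single i 1)) j := by
      let lam : (ι → K) →ₗ[K] K := (b.coord j).comp g
      have : lam v = _ := LinearMap.pi_apply_eq_sum_univ lam v
      change lam v = _
      rw [this]
      refine Finset.sum_congr rfl fun i _ => ?_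
      have : (fun j => if i = j then (1 : K) else 0) = Pi.single i 1 := by
        ext j; simp [Pi.single_apply, eq_comm]
      rw [this]; rfl
    rw [← h1, h2]
    refine Finset.sum_congr rfl fun i _ => ?_
    rw [map_mul, MvPolynomial.eval_C, MvPolynomial.eval_X, mul_comm]
  have hpr : (RingHom.ker φ).IsPrime := RingHom.ker_isPrime _
  refine ⟨hker ▸ hpr, ?_⟩
  rw [hker, tI]
  let e := Ideal.quotientKerAlgEquivOfSurjective hsurj
  have h3 : td K (MvPolynomial (Fin m) K) = m := by
    have := td_card (IsTranscendenceBasis.mvPolynomial (Fin m) K)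
    simpa using this
  apply le_antisymm
  · exact (td_inj e.toAlgHom e.injective).trans h3.le
  · have h4 : td K (MvPolynomial (Fin m) K) ≤ _ := td_inj e.symm.toAlgHom e.symm.injective
    rw [h3] at h4; exact h4

lemma zdim_PL [IsAlgClosed K] (L : Submodule K (ι → K)) (n : ℕ) :
    zdim (PL L) = ((n : ℕ∞) : WithBot ℕ∞) ↔ Module.finrank K L = n + 1 := by
  haveI := IsAlgClosed.instInfinite (K := K)
  by_cases hL : L = ⊥
  · subst hL
    have h1 : PL (⊥ : Submodule K (ι → K)) = ∅ := by
      rw [Set.eq_empty_iff_forall_notMem]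
      intro x hx
      have := hx (rep_mem x)
      exact x.rep_nonzero (by simpa using this)
    rw [h1, finrank_bot]
    have : IsEmpty {Y : Set (PP K ι) // IsZClosed Y ∧ IsZIrreducible Y ∧ Y ⊆ zclosure ∅} := by
      constructor
      rintro ⟨Y, _, hY, hs⟩
      rw [zclosure_eq isZClosed_empty] at hs
      obtain ⟨y, hy⟩ := hY.1
      exact hs hy
    rw [zdim, Order.krullDim_eq_bot]
    constructor
    · intro h; exact (WithBot.bot_ne_coe h).elim
    · intro h; omega
  · obtain ⟨hp, ht⟩ := tI_PL L hL
    have hI : IsIntegralVariety (PL L) := ⟨isZClosed_PL L, irred_of_prime (PL_nonempty hL) hp⟩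
    constructor
    · intro h; rw [← ht]; exact tI_of_zdim hI h
    · intro h
      apply le_antisymm
      · exact zdim_le (IX (PL L)) (closed_eq hI.1).subset n (by omega)
      · exact le_zdim n hI (by omega)

end ContactLoci

namespace ContactLoci
variable {K : Type*} [Field K] {ι : Type*} [Fintype ι]

lemma eval_sub {σ τ : Type*} (y : τ → K) (g : σ → MvPolynomial τ K) (F : MvPolynomial σ K) :
    MvPolynomial.eval y (MvPolynomial.aeval g F) =
      MvPolynomial.eval (fun p => MvPolynomial.eval y (g p)) F := by
  have : ((MvPolynomial.aeval y : MvPolynomial τ K →ₐ[K] K).comp (MvPolynomial.aeval g)) =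
      MvPolynomial.aeval (fun p => MvPolynomial.eval y (g p)) := by
    apply MvPolynomial.algHom_ext
    intro i
    rw [AlgHom.comp_apply, MvPolynomial.aeval_X, MvPolynomial.aeval_X]
    rfl
  exact congrArg (fun h : MvPolynomial σ K →ₐ[K] K => h F) this

/-- evaluation at a tuple of vectors -/
abbrev tev {m : ℕ} (v : Fin m → ι → K) (F : MvPolynomial (Fin m × ι) K) : K :=
  MvPolynomial.eval (fun p => v p.1 p.2) F

/-- ideal of the product of cones -/
def IXm (X : Set (PP K ι)) (m : ℕ) : Ideal (MvPolynomial (Fin m × ι) K) where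
  carrier := {f | ∀ v : Fin m → ι → K, (∀ j, v j ∈ coneOf X) → tev v f = 0}
  zero_mem' := fun v _ => map_zero _
  add_mem' := fun {a b} ha hb v hv => by
    have := ha v hv; have h2 := hb v hv
    simp only [tev] at *
    rw [map_add, this, h2, add_zero]
  smul_mem' := fun c f hf v hv => by
    have := hf v hv
    simp only [tev, smul_eq_mul] at *
    rw [map_mul, this, mul_zero]

lemma mem_IXm {X : Set (PP K ι)} {m : ℕ} {f : MvPolynomial (Fin m × ι) K} :
    f ∈ IXm X m ↔ ∀ v : Fin m → ι → K, (∀ j, v j ∈ coneOf X) → tev v f = 0 := Iff.rfl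

lemma not_mem_IXm {X : Set (PP K ι)} {m : ℕ} {f : MvPolynomial (Fin m × ι) K} :
    f ∉ IXm X m ↔ ∃ v : Fin m → ι → K, (∀ j, v j ∈ coneOf X) ∧ tev v f ≠ 0 := by
  rw [mem_IXm]; push Not; rfl

open Classical in
lemma exists_one_var {m : ℕ} (F : MvPolynomial (Fin m × ι) K) (v : Fin m → ι → K) (j : Fin m) :
    ∃ f : MvPolynomial ι K, ∀ y, MvPolynomial.eval y f = tev (Function.update v j y) F := by
  refine ⟨MvPolynomial.aeval (fun p => if p.1 = j then MvPolynomial.X p.2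
    else MvPolynomial.C (v p.1 p.2)) F, fun y => ?_⟩
  rw [eval_sub]
  unfold tev
  congr 2
  ext p
  by_cases h : p.1 = j
  · simp [h]
  · simp [h]

lemma IXm_prime [Infinite K] {X : Set (PP K ι)} (hX : IsZIrreducible X) (m : ℕ) :
    (IXm X m).IsPrime := by
  classical
  haveI := IX_prime hX
  constructor
  · intro h
    have : (1 : MvPolynomial (Fin m × ι) K) ∈ IXm X m := by rw [h]; trivial
    have := this (fun _ => 0) (fun _ => zero_mem_cone hX.1)
    simp at this
  · intro F G hFG
    by_contra hc
    push Not at hc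
    rw [not_mem_IXm, not_mem_IXm] at hc
    have key : ∀ s : Finset (Fin m), ∃ v w : Fin m → ι → K, (∀ j, v j ∈ coneOf X) ∧
        (∀ j, w j ∈ coneOf X) ∧ tev v F ≠ 0 ∧ tev w G ≠ 0 ∧ ∀ j ∈ s, v j = w j := by
      intro s
      induction s using Finset.induction_on with
      | empty =>
        obtain ⟨⟨v, hv, hv'⟩, w, hw, hw'⟩ := hc
        exact ⟨v, w, hv, hw, hv', hw', by simp⟩
      | insert j s hj ih =>
        obtain ⟨v, w, hv, hw, hv', hw', hs⟩ := ih
        obtain ⟨f, hf⟩ := exists_one_var F v j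
        obtain ⟨g, hg⟩ := exists_one_var G w j
        have hf0 : f ∉ IX X := fun h => hv' (by
          have := mem_IX'.1 h _ (hv j); rwa [hf, Function.update_eq_self] at this)
        have hg0 : g ∉ IX X := fun h => hw' (by
          have := mem_IX'.1 h _ (hw j); rwa [hg, Function.update_eq_self] at this)
        have hfg : f * g ∉ IX X := fun h => (Ideal.IsPrime.mem_or_mem ‹_› h).elim hf0 hg0
        rw [mem_IX'] at hfg
        push Not at hfg
        obtain ⟨y, hy, hy'⟩ := hfg
        rw [map_mul, hf, hg] at hy'
        refine ⟨Function.update v j y, Function.update w j y, ?_, ?_, left_ne_zero_of_mul hy',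
          right_ne_zero_of_mul hy', ?_⟩
        · intro l; by_cases h : l = j
          · subst h; simpa using hy
          · simpa [h] using hv l
        · intro l; by_cases h : l = j
          · subst h; simpa using hy
          · simpa [h] using hw l
        · intro l hl; by_cases h : l = j
          · subst h; simp
          · simpa [h] using hs l (by simpa [h] using hl)
    obtain ⟨v, w, hv, hw, hv', hw', hs⟩ := key Finset.univ
    have : v = w := funext fun j => hs j (Finset.mem_univ j)
    subst this
    have := hFG v hv
    simp only [tev, map_mul] at *
    exact mul_ne_zero hv' hw' this

lemma isAlg_transport {A B : Type*} [CommRing A] [CommRing B] [Algebra K A] [Algebra K B]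
    (h : A →ₐ[K] B) (hinj : Function.Injective h) (S : Set A) (T : Set B) (hST : h '' S ⊆ T) (a : A)
    (ha : IsAlgebraic (Algebra.adjoin K S) a) : IsAlgebraic (Algebra.adjoin K T) (h a) := by
  obtain ⟨p, hp0, hp⟩ := ha
  have hm : ∀ x : Algebra.adjoin K S, h x ∈ Algebra.adjoin K T := by
    rintro ⟨x, hx⟩
    have : h x ∈ (Algebra.adjoin K S).map h := ⟨x, hx, rfl⟩
    rw [AlgHom.map_adjoin] at this
    exact Algebra.adjoin_mono hST this
  let g : Algebra.adjoin K S →+* Algebra.adjoin K T :=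
    (h.toRingHom.comp (Algebra.adjoin K S).val.toRingHom).codRestrict _ hm
  have hg : Function.Injective g := by
    intro x y hxy
    apply Subtype.ext
    apply hinj
    exact congrArg Subtype.val hxy
  refine ⟨p.map g, (Polynomial.map_ne_zero_iff hg).2 hp0, ?_⟩
  have : h.toRingHom (Polynomial.aeval a p) = 0 := by rw [hp]; exact map_zero h
  rw [Polynomial.aeval_def, Polynomial.hom_eval₂] at this
  rw [Polynomial.aeval_def, Polynomial.eval₂_map]
  exact this

lemma tI_IXm [Infinite K] {X : Set (PP K ι)} (hX : IsZIrreducible X) (m : ℕ) :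
    tI (IXm X m) ≤ m * tI (IX X) := by
  classical
  haveI := IX_prime hX
  haveI := IXm_prime hX m
  let A := MvPolynomial ι K ⧸ IX X
  let B := MvPolynomial (Fin m × ι) K ⧸ IXm X m
  obtain ⟨y, hy⟩ := td_basis K A
  have hyalg := hy.isAlgebraic
  have hlift : ∀ j : Fin m, ∀ f ∈ IX X, ((Ideal.Quotient.mkₐ K (IXm X m)).comp
      (MvPolynomial.rename (fun i => (j, i)))) f = 0 := by
    intro j f hf
    refine Ideal.Quotient.eq_zero_iff_mem.2 ?_
    intro v hv
    change tev v (MvPolynomial.rename (fun i => (j, i)) f) = 0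
    rw [tev, MvPolynomial.eval_rename]
    exact mem_IX'.1 hf _ (hv j)
  let h : Fin m → A →ₐ[K] B := fun j => Ideal.Quotient.liftₐ (IX X) _ (hlift j)
  have hinj : ∀ j, Function.Injective (h j) := by
    intro j
    rw [injective_iff_map_eq_zero]
    intro a ha
    obtain ⟨f, rfl⟩ := Ideal.Quotient.mk_surjective a
    have ha' : Ideal.Quotient.mk (IXm X m) (MvPolynomial.rename (fun i => (j, i)) f) = 0 := ha
    rw [Ideal.Quotient.eq_zero_iff_mem] at ha' ⊢
    rw [mem_IX']
    intro v hv
    have := ha' (fun _ => v) (fun _ => hv)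
    rw [tev, MvPolynomial.eval_rename] at this
    exact this
  let T : Set B := Set.range (fun p : Fin m × Fin (td K A) => h p.1 (y p.2))
  have halg : ∀ j a, IsAlgebraic (Algebra.adjoin K T) (h j a) := by
    intro j a
    refine isAlg_transport (h j) (hinj j) (Set.range y) T ?_ a (hyalg.isAlgebraic a)
    rintro _ ⟨_, ⟨l, rfl⟩, rfl⟩
    exact ⟨(j, l), rfl⟩
  have hB : Algebra.IsAlgebraic (Algebra.adjoin K T) B := by
    constructor
    intro b
    obtain ⟨f, rfl⟩ := Ideal.Quotient.mk_surjective b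
    induction f using MvPolynomial.induction_on with
    | C c => 
      have : Ideal.Quotient.mk (IXm X m) (MvPolynomial.C c) =
        algebraMap (Algebra.adjoin K T) B (algebraMap K _ c) := rfl
      rw [this]; exact isAlgebraic_algebraMap _
    | add p q hp hq => rw [map_add]; exact hp.add hq
    | mul_X p i hp =>
      rw [map_mul]
      refine hp.mul ?_
      have : Ideal.Quotient.mk (IXm X m) (MvPolynomial.X i) =
          h i.1 (Ideal.Quotient.mk _ (MvPolynomial.X i.2)) := by
        change _ = Ideal.Quotient.mk (IXm X m) (MvPolynomial.rename _ _)
        rw [MvPolynomial.rename_X]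
      rw [this]; exact halg _ _
  have h1 := td_le_ncard (Set.finite_range _) hB
  refine h1.trans ?_
  have := Set.ncard_image_le (f := fun p : Fin m × Fin (td K A) => h p.1 (y p.2)) (s := Set.univ)
    Set.finite_univ
  rw [Set.image_univ, Set.ncard_univ] at this
  simpa [tI] using this

lemma exists_sum_of_mem_vspan {m : ℕ} (u : Fin m → PP K ι) {v : ι → K}
    (hv : v ∈ vspan (Set.range u)) : ∃ w : Fin m → ι → K, (∀ j, w j ∈ (u j).submodule) ∧
      v = ∑ j, w j := by
  have h1 : vspan (Set.range u) ≤ Submodule.span K (Set.range fun j => (u j).rep) := by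
    rw [vspan, Submodule.span_le]
    intro w hw
    obtain ⟨_, ⟨j, rfl⟩, hw⟩ := mem_coneOf.1 hw
    obtain ⟨c, rfl⟩ := mem_submodule_iff.1 hw
    exact Submodule.smul_mem _ _ (Submodule.subset_span ⟨j, rfl⟩)
  obtain ⟨c, hc⟩ := (Submodule.mem_span_range_iff_exists_fun K).1 (h1 hv)
  exact ⟨fun j => c j • (u j).rep, fun j => Submodule.smul_mem _ _ (rep_mem _), hc.symm⟩

lemma exists_sum_of_finset {m : ℕ} {X : Set (PP K ι)} {S : Finset (PP K ι)} (hS : ↑S ⊆ X)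
    (hc : S.card = m) : ∃ u : Fin m → PP K ι, (∀ j, u j ∈ X) ∧ Set.range u = S := by
  refine ⟨fun j => (S.equivFinOfCardEq hc).symm j, fun j => hS (Subtype.coe_prop _), ?_⟩
  ext x
  constructor
  · rintro ⟨j, rfl⟩; exact Subtype.coe_prop _
  · intro hx; exact ⟨S.equivFinOfCardEq hc ⟨x, hx⟩, by simp⟩

lemma secant_subset [Infinite K] {m : ℕ} {X : Set (PP K ι)} (Z : Set (MvPolynomial ι K))
    (h : ∀ w : Fin m → ι → K, (∀ j, w j ∈ coneOf X) → ∀ f ∈ Z, MvPolynomial.eval (∑ j, w j) f = 0) :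
    secant m X ⊆ zeroLocus Z := by
  refine zclosure_subset (isZClosed_locus _) ?_
  rintro q ⟨S, hS, hc, hq⟩ f hf v hv
  obtain ⟨u, hu, hr⟩ := exists_sum_of_finset hS hc
  have hv' : v ∈ vspan (Set.range u) := by rw [hr]; exact hq hv
  obtain ⟨w, hw, rfl⟩ := exists_sum_of_mem_vspan u hv'
  exact h w (fun j => mem_coneOf.2 ⟨u j, hu j, hw j⟩) f hf

lemma shift_poly (G : MvPolynomial ι K) (z : ι → K) : ∃ G' : MvPolynomial ι K,
    ∀ y, MvPolynomial.eval y G' = MvPolynomial.eval (y + z) G := by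
  refine ⟨MvPolynomial.aeval (fun i => MvPolynomial.X i + MvPolynomial.C (z i)) G, fun y => ?_⟩
  rw [eval_sub]
  congr 2
  ext i
  simp

/-- general points of the product are not covered by sums from a proper closed subset -/
lemma key_sum [Infinite K] {X : Set (PP K ι)} (hX : IsZIrreducible X) (k l n : ℕ)
    (hn : 2 ≤ (k + l) * (n + 1)) (ht : tI (IX X) = n + 1)
    (hsec : ((((k + l) * (n + 1) - 1 : ℕ) : ℕ∞) : WithBot ℕ∞) ≤ zdim (secant (k + l) X))
    (F : MvPolynomial (Fin k × ι) K) (hF : F ∉ IXm X k) :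
    ∃ v : Fin k → ι → K, (∀ j, v j ∈ coneOf X) ∧ ∃ G : MvPolynomial ι K,
      (∀ B : Fin k → ι → K, (∀ j, B j ∈ coneOf X) → tev B F = 0 →
        MvPolynomial.eval (∑ j, B j) G = 0) ∧ MvPolynomial.eval (∑ j, v j) G ≠ 0 := by
  by_contra hcon
  have hcon' : ∀ G : MvPolynomial ι K, (∀ B : Fin k → ι → K, (∀ j, B j ∈ coneOf X) →
      tev B F = 0 → MvPolynomial.eval (∑ j, B j) G = 0) →
      ∀ v : Fin k → ι → K, (∀ j, v j ∈ coneOf X) → MvPolynomial.eval (∑ j, v j) G = 0 := by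
    intro G hG v hv
    by_contra h
    exact hcon ⟨v, hv, G, hG, h⟩
  haveI hP := IXm_prime hX (k + l)
  let φ : MvPolynomial ι K →ₐ[K] MvPolynomial (Fin (k + l) × ι) K :=
    MvPolynomial.aeval fun i => ∑ j, MvPolynomial.X (j, i)
  have hφ : ∀ (w : Fin (k + l) → ι → K) G, tev w (φ G) = MvPolynomial.eval (∑ j, w j) G := by
    intro w G
    simp only [tev, φ]
    rw [eval_sub]
    congr 2
    ext i
    rw [map_sum, Finset.sum_apply]
    exact Finset.sum_congr rfl fun j _ => by rw [MvPolynomial.eval_X]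
  let F' : MvPolynomial (Fin (k + l) × ι) K :=
    MvPolynomial.rename (fun p : Fin k × ι => (Fin.castAdd l p.1, p.2)) F
  have hF' : ∀ w : Fin (k + l) → ι → K, tev w F' = tev (fun j => w (Fin.castAdd l j)) F := by
    intro w
    simp only [tev, F']
    rw [MvPolynomial.eval_rename]
    rfl
  let J : Ideal (MvPolynomial (Fin (k + l) × ι) K) := IXm X (k + l) ⊔ Ideal.span {F'}
  let q : Ideal (MvPolynomial ι K) := (IXm X (k + l)).comap φ
  haveI hq : q.IsPrime := Ideal.IsPrime.comap _
  have hJ : ∀ f ∈ J, ∀ w : Fin (k + l) → ι → K, (∀ j, w j ∈ coneOf X) → tev w F' = 0 →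
      tev w f = 0 := by
    intro f hf w hw hw0
    obtain ⟨a, ha, b, hb, rfl⟩ := Submodule.mem_sup.1 hf
    obtain ⟨c, rfl⟩ := Ideal.mem_span_singleton'.1 hb
    have h1 := ha w hw
    simp only [tev] at *
    rw [map_add, map_mul, hw0, h1, mul_zero, add_zero]
  let S : Submonoid (MvPolynomial (Fin (k + l) × ι) K) := q.primeCompl.map φ
  have hdis : Disjoint (J : Set (MvPolynomial (Fin (k + l) × ι) K)) (S : Set _) := by
    rw [Set.disjoint_left]
    rintro f hf ⟨G, hG, rfl⟩
    apply hG
    change φ G ∈ IXm X (k + l)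
    intro w hw
    rw [hφ, Fin.sum_univ_add]
    obtain ⟨G', hG'⟩ := shift_poly G (∑ i, w (Fin.natAdd k i))
    rw [← hG']
    refine hcon' G' ?_ _ fun j => hw _
    intro B hB hB0
    rw [hG']
    have h1 : ∀ j, Fin.append B (fun i => w (Fin.natAdd k i)) j ∈ coneOf X := by
      intro j
      refine Fin.addCases (fun j => ?_) (fun j => ?_) j
      · rw [Fin.append_left]; exact hB j
      · rw [Fin.append_right]; exact hw _
    have := hJ _ hf _ h1 (by
      rw [hF']; simp only [Fin.append_left]; exact hB0)
    have h2 : tev (Fin.append B (fun i => w (Fin.natAdd k i))) (φ G) = 0 := this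
    rw [hφ, Fin.sum_univ_add] at h2
    simp only [Fin.append_left, Fin.append_right] at h2
    exact h2
  obtain ⟨P, hPp, hJP, hPS⟩ := Ideal.exists_le_prime_disjoint _ _ hdis
  have hlt : IXm X (k + l) < P := by
    rw [SetLike.lt_iff_le_and_exists]
    refine ⟨le_sup_left.trans hJP, F', hJP (Ideal.mem_sup_right (Ideal.subset_span rfl)), ?_⟩
    obtain ⟨v, hv, hv0⟩ := not_mem_IXm.1 hF
    intro h
    have h1 := h (Fin.append v (fun _ => 0)) (by
      intro j
      refine Fin.addCases (fun j => ?_) (fun j => ?_) j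
      · rw [Fin.append_left]; exact hv j
      · rw [Fin.append_right]; exact zero_mem_cone hX.1)
    rw [hF'] at h1
    simp only [Fin.append_left] at h1
    exact hv0 h1
  have h1 := tI_strict hlt
  have h2 := tI_IXm hX (k + l)
  haveI : (P.comap φ).IsPrime := Ideal.IsPrime.comap _
  have h3 : P.comap φ ≤ q := by
    intro G hG
    by_contra hGq
    exact Set.disjoint_left.1 hPS hG ⟨G, hGq, rfl⟩
  have h4 := tI_anti h3
  have h5 := tI_comap φ P
  rw [ht] at h2
  have h6 : secant (k + l) X ⊆ zeroLocus (q : Set _) := by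
    apply secant_subset
    intro w hw f hf
    rw [← hφ]; exact hf w hw
  have h7 := zdim_le q h6 ((k + l) * (n + 1) - 2) (by omega)
  have h8 := hsec.trans h7
  have h9 : (k + l) * (n + 1) - 1 ≤ (k + l) * (n + 1) - 2 := by exact_mod_cast h8
  omega

end ContactLoci

namespace ContactLoci
variable {K : Type*} [Field K] {ι : Type*} [Fintype ι]

/-- Gradient pairing. -/
def gpL (f : MvPolynomial ι K) (v : ι → K) : (ι → K) →ₗ[K] K where
  toFun w := ∑ i, w i * MvPolynomial.eval v (MvPolynomial.pderiv i f)
  map_add' a b := by simp [add_mul, Finset.sum_add_distrib]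
  map_smul' a b := by simp [mul_assoc, Finset.mul_sum]

lemma gpL_apply (f : MvPolynomial ι K) (v w : ι → K) :
    gpL f v w = ∑ i, w i * MvPolynomial.eval v (MvPolynomial.pderiv i f) := rfl

/-- Affine tangent space. -/
def TV (X : Set (PP K ι)) (v : ι → K) : Submodule K (ι → K) :=
  ⨅ f ∈ homogVanishingIdeal X, LinearMap.ker (gpL f v)

lemma mem_TV {X : Set (PP K ι)} {v w : ι → K} :
    w ∈ TV X v ↔ ∀ f ∈ homogVanishingIdeal X, gpL f v w = 0 := by
  simp [TV, Submodule.mem_iInf]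

lemma embT_eq (X : Set (PP K ι)) (x : PP K ι) : embTangentSpace X x = PL (TV X x.rep) := by
  ext y
  change _ ↔ y.submodule ≤ _
  rw [submodule_le_iff, mem_TV]
  rfl

lemma TV_smul (X : Set (PP K ι)) (v : ι → K) {c : K} (hc : c ≠ 0) :
    TV X (c • v) = TV X v := by
  ext w
  rw [mem_TV, mem_TV]
  refine forall₂_congr fun f hf => ?_
  obtain ⟨⟨d, hd⟩, -⟩ := hf
  have : gpL f (c • v) w = c ^ (d - 1) * gpL f v w := by
    rw [gpL_apply, gpL_apply, Finset.mul_sum]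
    refine Finset.sum_congr rfl fun i _ => ?_
    rw [eval_smul_homog hd.pderiv]; ring
  rw [this, mul_eq_zero, or_iff_right (pow_ne_zero _ hc)]

lemma TV_rep (X : Set (PP K ι)) {x : PP K ι} {v : ι → K} (hv : v ∈ x.submodule) (h0 : v ≠ 0) :
    TV X v = TV X x.rep := by
  obtain ⟨c, rfl⟩ := mem_submodule_iff.1 hv
  exact TV_smul X _ (by rintro rfl; simp at h0)

lemma self_mem_TV {X : Set (PP K ι)} {v : ι → K} (hv : v ∈ coneOf X) : v ∈ TV X v := by
  rw [mem_TV]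
  rintro f ⟨⟨d, hd⟩, hf⟩
  obtain ⟨x, hx, hvx⟩ := mem_coneOf.1 hv
  have := congrArg (MvPolynomial.eval v) hd.sum_X_mul_pderiv
  rw [map_sum, map_nsmul, hf x hx v hvx, smul_zero] at this
  rw [gpL_apply, ← this]
  refine Finset.sum_congr rfl fun i _ => ?_
  rw [map_mul, MvPolynomial.eval_X]

lemma smooth_iff [IsAlgClosed K] {X : Set (PP K ι)} {n : ℕ}
    (hn : zdim X = ((n : ℕ∞) : WithBot ℕ∞)) (x : PP K ι) :
    IsSmoothPoint X x ↔ x ∈ X ∧ Module.finrank K (TV X x.rep) = n + 1 := by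
  rw [IsSmoothPoint, hn, embT_eq, zdim_PL]

lemma homog_mem_IX {X : Set (PP K ι)} {f : MvPolynomial ι K} (hf : f ∈ homogVanishingIdeal X) :
    f ∈ IX X := mem_IX.2 hf.2

lemma exists_dual_family {V : Type*} [AddCommGroup V] [Module K V] {c : ℕ} {g : Fin c → V}
    (hg : LinearIndependent K g) : ∃ T : V →ₗ[K] (Fin c → K), ∀ j, T (g j) = Pi.single j 1 := by
  let S : (Fin c → K) →ₗ[K] V := Fintype.linearCombination K g
  have hS : LinearMap.ker S = ⊥ := by
    rw [LinearMap.ker_eq_bot]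
    exact linearIndependent_iff_injective_fintypeLinearCombination.1 hg
  obtain ⟨T, hT⟩ := S.exists_leftInverse_of_injective hS
  refine ⟨T, fun j => ?_⟩
  have h1 := LinearMap.congr_fun hT (Pi.single j 1)
  have h2 : S (Pi.single j 1) = g j := by
    simp [S, Fintype.linearCombination_apply, Pi.single_apply]
  simpa [h2] using h1

lemma frame (X : Set (PP K ι)) (v0 : ι → K) :
    ∃ c : ℕ, c + Module.finrank K (TV X v0) = Fintype.card ι ∧
      ∃ f : Fin c → MvPolynomial ι K, (∀ j, f j ∈ homogVanishingIdeal X) ∧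
      ∃ b : Fin c → (ι → K), ∀ j l, gpL (f j) v0 (b l) = if j = l then 1 else 0 := by
  classical
  let s : Set (Module.Dual K (ι → K)) := (fun f => gpL f v0) '' homogVanishingIdeal X
  obtain ⟨g, hgs, hspan, hg⟩ := Submodule.exists_fun_fin_finrank_span_eq K s
  have hTV : (Submodule.span K s).dualCoannihilator = TV X v0 := by
    ext w
    rw [Submodule.mem_dualCoannihilator, mem_TV]
    constructor
    · intro h f hf
      exact h _ (Submodule.subset_span ⟨f, hf, rfl⟩)
    · intro h φ hφ
      induction hφ using Submodule.span_induction with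
      | mem x hx => obtain ⟨f, hf, rfl⟩ := hx; exact h f hf
      | zero => rfl
      | add x y _ _ hx hy => rw [LinearMap.add_apply, hx, hy, add_zero]
      | smul a x _ hx => rw [LinearMap.smul_apply, hx, smul_zero]
  have hrk := Subspace.finrank_add_finrank_dualCoannihilator_eq (Submodule.span K s)
  rw [hTV] at hrk
  refine ⟨_, by simpa using hrk, ?_⟩
  choose f hf hfg using hgs
  obtain ⟨T, hT⟩ := exists_dual_family hg
  refine ⟨f, hf, fun l => (Module.evalEquiv K (ι → K)).symm ((LinearMap.proj l).comp T), ?_⟩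
  intro j l
  have h1 : gpL (f j) v0 = g j := hfg j
  rw [h1]
  have h2 := Module.apply_evalEquiv_symm_apply K (ι → K) (g j) ((LinearMap.proj l).comp T)
  rw [h2, LinearMap.comp_apply, hT]
  simp [Pi.single_apply, eq_comm]

lemma frame_ker {c : ℕ} (f : Fin c → MvPolynomial ι K) (b : Fin c → (ι → K)) (v : ι → K)
    (hdet : (Matrix.of fun j l => gpL (f j) v (b l)).det ≠ 0) :
    c + Module.finrank K (LinearMap.ker (LinearMap.pi fun j => gpL (f j) v)) = Fintype.card ι := by
  classical
  have hsurj : LinearMap.range (LinearMap.pi fun j => gpL (f j) v) = ⊤ := by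
    rw [LinearMap.range_eq_top]
    intro y
    refine ⟨∑ l, ((Matrix.of fun j l => gpL (f j) v (b l))⁻¹.mulVec y) l • b l, ?_⟩
    have h2 : (Matrix.of fun j l => gpL (f j) v (b l)).mulVec
        ((Matrix.of fun j l => gpL (f j) v (b l))⁻¹.mulVec y) = y := by
      rw [Matrix.mulVec_mulVec, Matrix.mul_nonsing_inv _ (isUnit_iff_ne_zero.2 hdet),
        Matrix.one_mulVec]
    conv_rhs => rw [← h2]
    funext j
    rw [map_sum, Finset.sum_apply]
    simp only [map_smul, Pi.smul_apply, LinearMap.pi_apply, smul_eq_mul]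
    rw [Matrix.mulVec, dotProduct]
    refine Finset.sum_congr rfl fun l _ => ?_
    rw [Matrix.of_apply, mul_comm]
  have := LinearMap.finrank_range_add_finrank_ker (LinearMap.pi fun j => gpL (f j) v)
  rw [hsurj, finrank_top] at this
  simpa using this

/-- polynomial version of the pairing matrix -/
def pmat {c : ℕ} (f : Fin c → MvPolynomial ι K) (b : Fin c → (ι → K)) :
    Matrix (Fin c) (Fin c) (MvPolynomial ι K) :=
  Matrix.of fun j l => ∑ i, MvPolynomial.C (b l i) * MvPolynomial.pderiv i (f j)

lemma eval_pmat {c : ℕ} (f : Fin c → MvPolynomial ι K) (b : Fin c → (ι → K)) (v : ι → K) :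
    (MvPolynomial.eval v).mapMatrix (pmat f b) = Matrix.of fun j l => gpL (f j) v (b l) := by
  ext j l
  simp [pmat, gpL_apply, map_sum]

lemma eval_det_pmat {c : ℕ} (f : Fin c → MvPolynomial ι K) (b : Fin c → (ι → K)) (v : ι → K) :
    MvPolynomial.eval v (pmat f b).det = (Matrix.of fun j l => gpL (f j) v (b l)).det := by
  rw [RingHom.map_det, eval_pmat]

lemma det_frame {c : ℕ} {f : Fin c → MvPolynomial ι K} {b : Fin c → (ι → K)} {v : ι → K}
    (h : ∀ j l, gpL (f j) v (b l) = if j = l then 1 else 0) :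
    MvPolynomial.eval v (pmat f b).det = 1 := by
  rw [eval_det_pmat]
  have : (Matrix.of fun j l => gpL (f j) v (b l)) = 1 := by
    ext j l; rw [Matrix.of_apply, h, Matrix.one_apply]
  rw [this, Matrix.det_one]

lemma TV_le_ker {X : Set (PP K ι)} {c : ℕ} {f : Fin c → MvPolynomial ι K}
    (hf : ∀ j, f j ∈ homogVanishingIdeal X) (v : ι → K) :
    TV X v ≤ LinearMap.ker (LinearMap.pi fun j => gpL (f j) v) := by
  intro w hw
  rw [LinearMap.mem_ker]
  funext j
  exact mem_TV.1 hw _ (hf j)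

lemma tv_open (X : Set (PP K ι)) (v0 : ι → K) : ∃ F : MvPolynomial ι K,
    MvPolynomial.eval v0 F ≠ 0 ∧ ∀ v, MvPolynomial.eval v F ≠ 0 →
      Module.finrank K (TV X v) ≤ Module.finrank K (TV X v0) := by
  obtain ⟨c, hc, f, hf, b, hb⟩ := frame X v0
  refine ⟨(pmat f b).det, by rw [det_frame hb]; exact one_ne_zero, fun v hv => ?_⟩
  rw [eval_det_pmat] at hv
  have h1 := frame_ker f b v hv
  have h2 := Submodule.finrank_mono (TV_le_ker hf v)
  omega

lemma exists_field [Infinite K] {X : Set (PP K ι)} (hX : IsZIrreducible X) {v0 : ι → K}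
    (hv0 : v0 ∈ coneOf X)
    (hmin : ∀ v ∈ coneOf X, v ≠ 0 → Module.finrank K (TV X v0) ≤ Module.finrank K (TV X v))
    {w : ι → K} (hw : w ∈ TV X v0) :
    ∃ W : ι → MvPolynomial ι K, (∀ i, MvPolynomial.eval v0 (W i) = w i) ∧
      ∀ v ∈ coneOf X, v ≠ 0 → (fun i => MvPolynomial.eval v (W i)) ∈ TV X v := by
  haveI := IX_prime hX
  obtain ⟨c, hc, f, hf, b, hb⟩ := frame X v0
  let p : Fin c → MvPolynomial ι K := fun j => ∑ i, MvPolynomial.C (w i) * MvPolynomial.pderiv i (f j)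
  have hp : ∀ v j, MvPolynomial.eval v (p j) = gpL (f j) v w := by
    intro v j; simp [p, gpL_apply, map_sum]
  let W : ι → MvPolynomial ι K := fun i => (pmat f b).det * MvPolynomial.C (w i) -
    ∑ l, ((pmat f b).adjugate.mulVec p) l * MvPolynomial.C (b l i)
  have hWv : ∀ v, (fun i => MvPolynomial.eval v (W i)) = MvPolynomial.eval v (pmat f b).det • w -
      ∑ l, MvPolynomial.eval v (((pmat f b).adjugate.mulVec p) l) • b l := by
    intro v; funext i
    simp [W, map_sum]
  have hkey : ∀ v j, gpL (f j) v (fun i => MvPolynomial.eval v (W i)) = 0 := by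
    intro v j
    rw [hWv, map_sub, map_smul, map_sum]
    have h1 : ((pmat f b).mulVec ((pmat f b).adjugate.mulVec p)) j = (pmat f b).det * p j := by
      rw [Matrix.mulVec_mulVec, Matrix.mul_adjugate, Matrix.smul_mulVec, Matrix.one_mulVec]; rfl
    have h2 := congrArg (MvPolynomial.eval v) h1
    rw [map_mul, hp, Matrix.mulVec, dotProduct, map_sum] at h2
    rw [smul_eq_mul, ← h2, sub_eq_zero]
    refine Finset.sum_congr rfl fun l _ => ?_
    have h3 : MvPolynomial.eval v (pmat f b j l) = gpL (f j) v (b l) :=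
      congrFun (congrFun (eval_pmat f b v) j) l
    rw [map_mul, h3, map_smul, smul_eq_mul, mul_comm]
  refine ⟨W, fun i => ?_, fun v hv hv00 => ?_⟩
  · have := congrFun (hWv v0) i
    refine this.trans ?_
    have hz : ∀ l, MvPolynomial.eval v0 (((pmat f b).adjugate.mulVec p) l) = 0 := by
      intro l
      rw [Matrix.mulVec, dotProduct, map_sum]
      refine Finset.sum_eq_zero fun j _ => ?_
      rw [map_mul, hp, mem_TV.1 hw _ (hf j), mul_zero]
    simp [hz, det_frame hb]
  · rw [mem_TV]
    intro g hg
    let q : MvPolynomial ι K := ∑ i, W i * MvPolynomial.pderiv i g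
    have hq : ∀ v, MvPolynomial.eval v q = gpL g v (fun i => MvPolynomial.eval v (W i)) := by
      intro v; simp [q, gpL_apply, map_sum]
    obtain ⟨i0, hi0⟩ : ∃ i, v i ≠ 0 := by
      by_contra h; push Not at h; exact hv00 (funext h)
    have hmem : (pmat f b).det * (q * MvPolynomial.X i0) ∈ IX X := by
      rw [mem_IX']
      intro y hy
      rw [map_mul, map_mul, MvPolynomial.eval_X]
      by_cases hd : MvPolynomial.eval y (pmat f b).det = 0
      · rw [hd, zero_mul]
      by_cases hy0 : y = 0
      · subst hy0; simp
      have hd' := hd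
      rw [eval_det_pmat] at hd'
      have h1 := frame_ker f b y hd'
      have h2 := hmin y hy hy0
      have h3 := Submodule.eq_of_le_of_finrank_le (TV_le_ker hf y) (by omega)
      have h4 : (fun i => MvPolynomial.eval y (W i)) ∈ TV X y := by
        rw [h3, LinearMap.mem_ker]; funext j; exact hkey y j
      rw [hq, mem_TV.1 h4 g hg]; simp
    rcases (IX_prime hX).mem_or_mem hmem with h | h
    · have := mem_IX'.1 h v0 hv0
      rw [det_frame hb] at this; exact absurd this one_ne_zero
    · have := mem_IX'.1 h v hv
      rw [map_mul, MvPolynomial.eval_X, hq] at this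
      exact (mul_eq_zero.1 this).resolve_right hi0

end ContactLoci

namespace ContactLoci
variable {K : Type*} [Field K] {ι : Type*} [Fintype ι]

lemma rep_mem_cone {X : Set (PP K ι)} {x : PP K ι} (hx : x ∈ X) : x.rep ∈ coneOf X :=
  mem_coneOf.2 ⟨x, hx, rep_mem x⟩

lemma functional_poly (ψ : (ι → K) →ₗ[K] K) {τ : Type*} (W : ι → MvPolynomial τ K) :
    ∃ p : MvPolynomial τ K, ∀ v, MvPolynomial.eval v p = ψ (fun i => MvPolynomial.eval v (W i)) := by
  classical
  refine ⟨∑ i, W i * MvPolynomial.C (ψ (Pi.single i 1)), fun v => ?_⟩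
  rw [map_sum, LinearMap.pi_apply_eq_sum_univ ψ]
  refine Finset.sum_congr rfl fun i _ => ?_
  rw [map_mul, MvPolynomial.eval_C, smul_eq_mul]
  congr 2
  funext j
  simp [Pi.single_apply, eq_comm]

lemma closed_tangency [IsAlgClosed K] {X : Set (PP K ι)} (hX : IsZIrreducible X) {n : ℕ}
    (hn : zdim X = ((n : ℕ∞) : WithBot ℕ∞))
    (hmin : ∀ v ∈ coneOf X, v ≠ 0 → n + 1 ≤ Module.finrank K (TV X v))
    {E : Set (PP K ι)} (hE : E ⊆ X) {M : Submodule K (ι → K)} (hM : ∀ x ∈ E, TV X x.rep ≤ M)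
    {x0 : PP K ι} (hx0 : x0 ∈ zclosure E) (hs : IsSmoothPoint X x0) : TV X x0.rep ≤ M := by
  haveI := IsAlgClosed.instInfinite (K := K)
  rw [smooth_iff hn] at hs
  intro w hw
  by_contra hwM
  obtain ⟨ψ, hψ, hMψ⟩ := Submodule.exists_le_ker_of_notMem hwM
  obtain ⟨W, hW0, hW⟩ := exists_field hX (rep_mem_cone hs.1)
    (fun v hv h0 => by rw [hs.2]; exact hmin v hv h0) hw
  obtain ⟨p, hp⟩ := functional_poly ψ W
  obtain ⟨i, hi⟩ := exists_coord x0
  have hsub : zclosure E ⊆ zeroLocus {p * MvPolynomial.X i} := by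
    refine zclosure_subset (isZClosed_locus _) ?_
    rintro x hx _ rfl v hv
    rw [map_mul, MvPolynomial.eval_X]
    by_cases hv0 : v = 0
    · subst hv0; simp
    have h1 := hW v (mem_coneOf.2 ⟨x, hE hx, hv⟩) hv0
    rw [TV_rep X hv hv0] at h1
    have h2 := hMψ (hM x hx h1)
    rw [LinearMap.mem_ker] at h2
    rw [hp, h2, zero_mul]
  have := hsub hx0 _ rfl _ (rep_mem x0)
  rw [map_mul, MvPolynomial.eval_X, hp, funext hW0] at this
  exact (mul_ne_zero hψ hi) this

lemma smooth_open [IsAlgClosed K] {X : Set (PP K ι)} {n : ℕ}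
    (hn : zdim X = ((n : ℕ∞) : WithBot ℕ∞))
    (hmin : ∀ v ∈ coneOf X, v ≠ 0 → n + 1 ≤ Module.finrank K (TV X v))
    {x0 : PP K ι} (hs : IsSmoothPoint X x0) : ∃ F : MvPolynomial ι K,
      MvPolynomial.eval x0.rep F ≠ 0 ∧ ∀ x ∈ X, ∀ v ∈ x.submodule, MvPolynomial.eval v F ≠ 0 →
        v ≠ 0 ∧ IsSmoothPoint X x := by
  rw [smooth_iff hn] at hs
  obtain ⟨F, hF0, hF⟩ := tv_open X x0.rep
  obtain ⟨i, hi⟩ := exists_coord x0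
  refine ⟨F * MvPolynomial.X i, by rw [map_mul, MvPolynomial.eval_X]; exact mul_ne_zero hF0 hi, ?_⟩
  intro x hx v hv h
  rw [map_mul, MvPolynomial.eval_X] at h
  have hv0 : v ≠ 0 := by rintro rfl; simp at h
  refine ⟨hv0, ?_⟩
  rw [smooth_iff hn]
  refine ⟨hx, ?_⟩
  rw [← TV_rep X hv hv0]
  have h1 := hF v (left_ne_zero_of_mul h)
  have h2 := hmin v (mem_coneOf.2 ⟨x, hx, hv⟩) hv0
  omega

lemma exists_bad [IsAlgClosed K] {X : Set (PP K ι)} {n : ℕ}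
    (hn : zdim X = ((n : ℕ∞) : WithBot ℕ∞))
    (hmin : ∀ v ∈ coneOf X, v ≠ 0 → n + 1 ≤ Module.finrank K (TV X v)) :
    ∃ Bad : Set (PP K ι), IsZClosed Bad ∧ ∀ x ∈ X, x ∉ Bad ↔ IsSmoothPoint X x := by
  haveI := IsAlgClosed.instInfinite (K := K)
  refine ⟨zeroLocus {F | ∀ x ∈ X, ∀ v ∈ x.submodule, MvPolynomial.eval v F ≠ 0 →
        v ≠ 0 ∧ IsSmoothPoint X x}, isZClosed_locus _, fun x hx => ⟨fun h => ?_, fun h hb => ?_⟩⟩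
  · have : ∃ F : MvPolynomial ι K, (∀ x ∈ X, ∀ v ∈ x.submodule, MvPolynomial.eval v F ≠ 0 →
        v ≠ 0 ∧ IsSmoothPoint X x) ∧ ∃ v ∈ x.submodule, MvPolynomial.eval v F ≠ 0 := by
      by_contra h'
      push Not at h'
      exact h fun F hF v hv => h' F hF v hv
    obtain ⟨F, hF, v, hv, hne⟩ := this
    exact (hF x hx v hv hne).2
  · obtain ⟨F, hF0, hF⟩ := smooth_open hn hmin h
    exact hF0 (hb F hF _ (rep_mem x))

lemma irr_diff [Infinite K] {E Bad : Set (PP K ι)} (hE : IsZIrreducible E) (hB : IsZClosed Bad)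
    (hne : (E \ Bad).Nonempty) : IsZIrreducible (E \ Bad) ∧ E ⊆ zclosure (E \ Bad) := by
  have hnB : ¬ E ⊆ Bad := fun h => by obtain ⟨x, hx, hx'⟩ := hne; exact hx' (h hx)
  refine ⟨⟨hne, fun Y Z hY hZ hs => ?_⟩, ?_⟩
  · have : E ⊆ Bad ∪ (Y ∪ Z) := by
      intro x hx
      by_cases h : x ∈ Bad
      · exact Or.inl h
      · exact Or.inr (hs ⟨hx, h⟩)
    have h2 := (hE.2 _ _ hB (isZClosed_union hY hZ) this).resolve_left hnB
    rcases hE.2 _ _ hY hZ h2 with h | h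
    · exact Or.inl fun x hx => h hx.1
    · exact Or.inr fun x hx => h hx.1
  · have : E ⊆ Bad ∪ zclosure (E \ Bad) := by
      intro x hx
      by_cases h : x ∈ Bad
      · exact Or.inl h
      · exact Or.inr (subset_zclosure _ ⟨hx, h⟩)
    exact (hE.2 _ _ hB (isZClosed_zclosure _) this).resolve_left hnB

lemma singleton_irred (x : PP K ι) : IsZIrreducible ({x} : Set (PP K ι)) := by
  refine ⟨⟨x, rfl⟩, fun Y Z _ _ h => ?_⟩
  rcases h rfl with h | h
  · exact Or.inl (by rintro _ rfl; exact h)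
  · exact Or.inr (by rintro _ rfl; exact h)

lemma semicont [IsAlgClosed K] {X : Set (PP K ι)} (hX : IsZIrreducible X) {n k : ℕ}
    (hmin : ∀ v ∈ coneOf X, v ≠ 0 → n + 1 ≤ Module.finrank K (TV X v))
    {v0 : Fin k → ι → K} (hv0 : ∀ j, v0 j ∈ coneOf X)
    (hs : ∀ j, Module.finrank K (TV X (v0 j)) = n + 1) :
    ∃ F : MvPolynomial (Fin k × ι) K, tev v0 F ≠ 0 ∧ ∀ v : Fin k → ι → K,
      (∀ j, v j ∈ coneOf X) → (∀ j, v j ≠ 0) → tev v F ≠ 0 →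
      Module.finrank K (⨆ j, TV X (v0 j) : Submodule K (ι → K)) ≤
        Module.finrank K (⨆ j, TV X (v j) : Submodule K (ι → K)) := by
  classical
  haveI := IsAlgClosed.instInfinite (K := K)
  obtain ⟨w, hws, hwspan, hw⟩ := Submodule.exists_fun_fin_finrank_span_eq K
    (⋃ j, (TV X (v0 j) : Set (ι → K)))
  have hsp : ∀ v : Fin k → ι → K, Submodule.span K (⋃ j, (TV X (v j) : Set (ι → K))) =
      ⨆ j, TV X (v j) := by
    intro v; rw [Submodule.span_iUnion]; simp
  rw [← hsp v0]
  have hws' : ∀ s, ∃ j, w s ∈ TV X (v0 j) := fun s => by simpa using hws s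
  choose j hj using hws'
  have hf := fun s => exists_field hX (hv0 (j s))
    (fun v hv h0 => by rw [hs]; exact hmin v hv h0) (hj s)
  choose W hW0 hW using hf
  obtain ⟨T, hT⟩ := exists_dual_family hw
  have hpol : ∀ s t, ∃ p : MvPolynomial (Fin k × ι) K, ∀ v : Fin k → ι → K,
      tev v p = T (fun i => MvPolynomial.eval (v (j s)) (W s i)) t := by
    intro s t
    obtain ⟨p, hp⟩ := functional_poly ((LinearMap.proj t).comp T)
      (fun i => MvPolynomial.rename (fun i => (j s, i)) (W s i))
    refine ⟨p, fun v => ?_⟩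
    rw [tev, hp]
    simp only [MvPolynomial.eval_rename]
    rfl
  choose p hp using hpol
  have hdet : ∀ v : Fin k → ι → K, tev v (Matrix.of p).det =
      (Matrix.of fun s => T (fun i => MvPolynomial.eval (v (j s)) (W s i))).det := by
    intro v
    rw [tev, RingHom.map_det]
    congr 1
    ext s t
    exact hp s t v
  refine ⟨(Matrix.of p).det, ?_, fun v hv hvn hne => ?_⟩
  · rw [hdet]
    have : (Matrix.of fun s => T (fun i => MvPolynomial.eval (v0 (j s)) (W s i))) = 1 := by
      ext s t
      rw [Matrix.of_apply, funext (hW0 s)]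
      change T (w s) t = _
      rw [hT, Matrix.one_apply, Pi.single_apply]; simp [eq_comm]
    rw [this, Matrix.det_one]; exact one_ne_zero
  · rw [hdet] at hne
    have h1 := Matrix.linearIndependent_rows_of_det_ne_zero hne
    have h2 : LinearIndependent K fun s => (fun i => MvPolynomial.eval (v (j s)) (W s i)) :=
      LinearIndependent.of_comp T h1
    have h3 : Submodule.span K (Set.range fun s => (fun i => MvPolynomial.eval (v (j s)) (W s i)))
        ≤ ⨆ j, TV X (v j) := by
      rw [Submodule.span_le]
      rintro _ ⟨s, rfl⟩
      exact Submodule.mem_iSup_of_mem (j s) (hW s _ (hv _) (hvn _))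
    have h4 := Submodule.finrank_mono h3
    rw [finrank_span_eq_card h2, Fintype.card_fin] at h4
    exact h4

lemma tangentSpan_eq (X : Set (PP K ι)) {k : ℕ} (u : Fin k → PP K ι) :
    tangentSpan X (Set.range u) = PL (⨆ j, TV X (u j).rep) := by
  rw [tangentSpan, projSpan_eq_PL]
  congr 1
  apply le_antisymm
  · rw [vspan, Submodule.span_le]
    intro v hv
    obtain ⟨x, hx, hvx⟩ := mem_coneOf.1 hv
    simp only [Set.mem_iUnion, Set.mem_range] at hx
    obtain ⟨_, ⟨j, rfl⟩, hx⟩ := hx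
    rw [embT_eq] at hx
    exact Submodule.mem_iSup_of_mem j (hx hvx)
  · refine iSup_le fun j => ?_
    rw [← vspan_PL (TV X (u j).rep), ← embT_eq]
    exact vspan_mono fun x hx => Set.mem_biUnion (Set.mem_range_self j) hx

lemma mem_tangencyLocus (X : Set (PP K ι)) {k : ℕ} (u : Fin k → PP K ι) (x : PP K ι) :
    x ∈ tangencyLocus X (Set.range u) ↔ IsSmoothPoint X x ∧
      TV X x.rep ≤ ⨆ j, TV X (u j).rep := by
  rw [← PL_le_iff, ← tangentSpan_eq, ← embT_eq]; rfl

end ContactLoci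

namespace ContactLoci
variable {K : Type*} [Field K] {ι : Type*} [Fintype ι]

lemma open_poly {X : Set (PP K ι)} {k : ℕ} {T : Set (Fin k → PP K ι)} (hT : IsMultiZClosed T)
    (hu : ∃ u : Fin k → PP K ι, (∀ i, u i ∈ X) ∧ u ∉ T) :
    ∃ F : MvPolynomial (Fin k × ι) K, F ∉ IXm X k ∧ ∀ (u : Fin k → PP K ι) (v : Fin k → ι → K),
      (∀ i, v i ∈ (u i).submodule) → tev v F ≠ 0 → u ∉ T := by
  obtain ⟨S, -, rfl⟩ := hT
  obtain ⟨u, huX, hu⟩ := hu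
  have : ∃ f ∈ S, ∃ v : Fin k → ι → K, (∀ i, v i ∈ (u i).submodule) ∧ tev v f ≠ 0 := by
    by_contra h
    push Not at h
    exact hu fun f hf v hv => h f hf v hv
  obtain ⟨f, hf, v, hv, hne⟩ := this
  refine ⟨f, not_mem_IXm.2 ⟨v, fun j => mem_coneOf.2 ⟨u j, huX j, hv j⟩, hne⟩, ?_⟩
  intro u' v' hv' hne' hu'
  exact hne' (hu' f hf v' hv')

/-- product over the blocks -/
def blockProd (k : ℕ) (F : MvPolynomial ι K) : MvPolynomial (Fin k × ι) K :=
  ∏ j : Fin k, MvPolynomial.rename (fun i => (j, i)) F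

lemma tev_blockProd {k : ℕ} (F : MvPolynomial ι K) (v : Fin k → ι → K) :
    tev v (blockProd k F) = ∏ j, MvPolynomial.eval (v j) F := by
  rw [tev, blockProd, map_prod]
  refine Finset.prod_congr rfl fun j _ => ?_
  rw [MvPolynomial.eval_rename]; rfl

lemma blockProd_notMem {X : Set (PP K ι)} {k : ℕ} {F : MvPolynomial ι K} {y : ι → K}
    (hy : y ∈ coneOf X) (hF : MvPolynomial.eval y F ≠ 0) : blockProd k F ∉ IXm X k := by
  refine not_mem_IXm.2 ⟨fun _ => y, fun _ => hy, ?_⟩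
  rw [tev_blockProd]
  exact Finset.prod_ne_zero_iff.2 fun _ _ => hF

lemma blockProd_ne {k : ℕ} {F : MvPolynomial ι K} {v : Fin k → ι → K}
    (h : tev v (blockProd k F) ≠ 0) (j : Fin k) : MvPolynomial.eval (v j) F ≠ 0 := by
  rw [tev_blockProd] at h
  exact Finset.prod_ne_zero_iff.1 h j (Finset.mem_univ _)

lemma mem_contact [Infinite K] {X A C : Set (PP K ι)} (hC : IsZIrredComponent (tangencyLocus X A) C)
    (hA : (C ∩ A).Nonempty) : C ⊆ contactLocus X A := by
  refine Set.Subset.trans ?_ (subset_zclosure _)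
  exact Set.subset_biUnion_of_mem (u := fun C => C) (show C ∈ {C : Set (PP K ι) |
    IsZIrredComponent (tangencyLocus X A) C ∧ (C ∩ A).Nonempty} from ⟨hC, hA⟩)

lemma contact_smooth [Infinite K] {X A : Set (PP K ι)} (h : (contactLocus X A).Nonempty) :
    ∃ x ∈ A, IsSmoothPoint X x := by
  by_contra hcon
  push Not at hcon
  obtain ⟨x, hx⟩ := h
  have : contactLocus X A ⊆ ∅ := by
    refine zclosure_subset isZClosed_empty ?_
    intro y hy
    simp only [Set.mem_iUnion] at hy
    obtain ⟨C, ⟨hC, z, hzC, hzA⟩, -⟩ := hy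
    exact absurd (hC.2.1 hzC).1 (hcon z hzA)
  exact this hx

lemma choose_points {X : Set (PP K ι)} {k : ℕ} {v : Fin k → ι → K} (hv : ∀ j, v j ∈ coneOf X) :
    ∃ u : Fin k → PP K ι, (∀ j, u j ∈ X) ∧ ∀ j, v j ∈ (u j).submodule := by
  choose u h1 h2 using fun j => mem_coneOf.1 (hv j)
  exact ⟨u, h1, h2⟩

lemma hmin_of_typeI [IsAlgClosed K] {X : Set (PP K ι)} (hX : IsZIrreducible X) {n k : ℕ}
    (hn : zdim X = ((n : ℕ∞) : WithBot ℕ∞))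
    (htypeI : HoldsForGeneralTuples X k fun u =>
      IsZIrreducible (contactLocus X (Set.range u))) :
    ∀ v ∈ coneOf X, v ≠ 0 → n + 1 ≤ Module.finrank K (TV X v) := by
  haveI := IsAlgClosed.instInfinite (K := K)
  intro y hy hy0
  by_contra hlt
  obtain ⟨T, hT, hne, hP⟩ := htypeI
  obtain ⟨F, hF, hFT⟩ := open_poly hT hne
  obtain ⟨i, hi⟩ : ∃ i, y i ≠ 0 := by
    by_contra h; push Not at h; exact hy0 (funext h)
  obtain ⟨H, hH0, hH⟩ := tv_open X y
  have hHX : MvPolynomial.eval y (H * MvPolynomial.X i) ≠ 0 := by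
    rw [map_mul, MvPolynomial.eval_X]; exact mul_ne_zero hH0 hi
  have hprod : F * blockProd k (H * MvPolynomial.X i) ∉ IXm X k := fun h =>
    ((IXm_prime hX k).mem_or_mem h).elim hF (blockProd_notMem hy hHX)
  obtain ⟨v, hv, hvne⟩ := not_mem_IXm.1 hprod
  rw [tev, map_mul] at hvne
  obtain ⟨u, huX, huv⟩ := choose_points hv
  have hirr := hP u huX (hFT u v huv (left_ne_zero_of_mul hvne))
  obtain ⟨_, ⟨j, rfl⟩, hj⟩ := contact_smooth hirr.1
  have h1 := blockProd_ne (right_ne_zero_of_mul hvne) j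
  rw [map_mul, MvPolynomial.eval_X] at h1
  have hvj : v j ≠ 0 := by intro h; rw [h] at h1; simp at h1
  have h2 := hH (v j) (left_ne_zero_of_mul h1)
  rw [TV_rep X (huv j) hvj] at h2
  have h3 := ((smooth_iff hn _).1 hj).2
  omega

lemma exists_F0 [IsAlgClosed K] {X : Set (PP K ι)} (hX : IsZIrreducible X) {n k : ℕ}
    (hn : zdim X = ((n : ℕ∞) : WithBot ℕ∞))
    (htypeI : HoldsForGeneralTuples X k fun u =>
      IsZIrreducible (contactLocus X (Set.range u))) :
    ∃ (F : MvPolynomial (Fin k × ι) K) (e : ℕ), F ∉ IXm X k ∧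
      ∀ (u : Fin k → PP K ι) (v : Fin k → ι → K), (∀ i, u i ∈ X) → (∀ i, v i ∈ (u i).submodule) →
      tev v F ≠ 0 → (∀ i, v i ≠ 0) ∧ (∀ i, IsSmoothPoint X (u i)) ∧
        IsZIrreducible (contactLocus X (Set.range u)) ∧
        Module.finrank K (⨆ j, TV X (u j).rep : Submodule K (ι → K)) = e := by
  haveI := IsAlgClosed.instInfinite (K := K)
  have hmin := hmin_of_typeI hX hn htypeI
  obtain ⟨T, hT, hne, hP⟩ := htypeI
  obtain ⟨F, hF, hFT⟩ := open_poly hT hne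
  obtain ⟨u0, hu0X, hu0T⟩ := hne
  obtain ⟨x0, -, hx0⟩ := contact_smooth (hP u0 hu0X hu0T).1
  obtain ⟨S, hS0, hS⟩ := smooth_open hn hmin hx0
  let A : Set ℕ := {m | ∃ u : Fin k → PP K ι, (∀ j, IsSmoothPoint X (u j)) ∧
    Module.finrank K (⨆ j, TV X (u j).rep : Submodule K (ι → K)) = m}
  have hAne : A.Nonempty := ⟨_, fun _ => x0, fun _ => hx0, rfl⟩
  have hAb : BddAbove A := by
    refine ⟨Fintype.card ι, ?_⟩
    rintro _ ⟨u, -, rfl⟩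
    simpa using Submodule.finrank_le (⨆ j, TV X (u j).rep : Submodule K (ι → K))
  obtain ⟨u1, hu1, he⟩ := Nat.sSup_mem hAne hAb
  obtain ⟨H, hH0, hH⟩ := semicont hX hmin (v0 := fun j => (u1 j).rep)
    (fun j => rep_mem_cone (hu1 j).1) (fun j => ((smooth_iff hn _).1 (hu1 j)).2)
  refine ⟨F * blockProd k S * H, sSup A, ?_, ?_⟩
  · intro h
    rcases (IXm_prime hX k).mem_or_mem h with h | h
    · exact ((IXm_prime hX k).mem_or_mem h).elim hF (blockProd_notMem (rep_mem_cone hx0.1) hS0)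
    · exact hH0 (h _ fun j => rep_mem_cone (hu1 j).1)
  · intro u v hu huv hne
    rw [tev, map_mul, map_mul] at hne
    have h1 := left_ne_zero_of_mul (left_ne_zero_of_mul hne)
    have h2 := blockProd_ne (right_ne_zero_of_mul (left_ne_zero_of_mul hne))
    have h3 := right_ne_zero_of_mul hne
    have h4 := fun j => hS (u j) (hu j) (v j) (huv j) (h2 j)
    refine ⟨fun i => (h4 i).1, fun i => (h4 i).2, hP u hu (hFT u v huv h1), le_antisymm ?_ ?_⟩
    · exact le_csSup hAb ⟨u, fun i => (h4 i).2, rfl⟩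
    · refine he.symm.le.trans ?_
      have h5 := hH v (fun j => mem_coneOf.2 ⟨u j, hu j, huv j⟩) (fun i => (h4 i).1) h3
      have h6 : ∀ j, TV X (v j) = TV X (u j).rep := fun j => TV_rep X (huv j) (h4 j).1
      have h7 : (⨆ j, TV X (v j)) = ⨆ j, TV X (u j).rep := iSup_congr h6
      rw [h7] at h5
      exact h5

lemma mem_vspan_pair {p q : PP K ι} {v : ι → K} (hv : v ∈ vspan {p, q}) :
    ∃ s ∈ p.submodule, ∃ t ∈ q.submodule, s + t = v := by
  have : vspan {p, q} ≤ p.submodule ⊔ q.submodule := by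
    rw [vspan, Submodule.span_le]
    intro w hw
    obtain ⟨x, hx, hwx⟩ := mem_coneOf.1 hw
    rcases hx with rfl | rfl
    · exact Submodule.mem_sup_left hwx
    · exact Submodule.mem_sup_right hwx
  exact Submodule.mem_sup.1 (this hv)

lemma join_subset [Infinite K] {W Γ : Set (PP K ι)} {a b : ℕ} (Z : Set (MvPolynomial ι K))
    (h : ∀ (w : Fin a → ι → K) (y : Fin b → ι → K), (∀ j, w j ∈ coneOf W) → (∀ j, y j ∈ coneOf Γ) →
      ∀ f ∈ Z, MvPolynomial.eval (∑ j, w j + ∑ j, y j) f = 0) :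
    join (secant a W) (secant b Γ) ⊆ zeroLocus Z := by
  have step1 : ∀ y : Fin b → ι → K, (∀ j, y j ∈ coneOf Γ) → ∀ p ∈ secant a W, ∀ s ∈ p.submodule,
      ∀ f ∈ Z, MvPolynomial.eval (s + ∑ j, y j) f = 0 := by
    intro y hy p hp s hs f hf
    obtain ⟨f', hf'⟩ := shift_poly f (∑ j, y j)
    rw [← hf']
    refine secant_subset {f'} ?_ hp f' rfl s hs
    rintro w hw _ rfl
    rw [hf']; exact h w y hw hy f hf
  refine zclosure_subset (isZClosed_locus _) ?_
  intro x hx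
  simp only [Set.mem_iUnion] at hx
  obtain ⟨p, hp, q, hq, hx⟩ := hx
  intro f hf v hv
  obtain ⟨s, hs, t, ht, rfl⟩ := mem_vspan_pair (hx hv)
  obtain ⟨f', hf'⟩ := shift_poly f s
  rw [add_comm, ← hf']
  refine secant_subset {f'} ?_ hq f' rfl t ht
  rintro y hy _ rfl
  rw [hf', add_comm]; exact step1 y hy p hp s hs f hf

lemma join_zero [Infinite K] (A Γ : Set (PP K ι)) : join A (secant 0 Γ) ⊆ ∅ := by
  have h0 : secant 0 Γ ⊆ ∅ := by
    refine zclosure_subset isZClosed_empty ?_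
    rintro q ⟨S, -, hS, hq⟩
    rw [Finset.card_eq_zero] at hS
    subst hS
    have := hq (rep_mem q)
    simp [vspan, coneOf] at this
    exact absurd this q.rep_nonzero
  refine zclosure_subset isZClosed_empty ?_
  intro x hx
  simp only [Set.mem_iUnion] at hx
  obtain ⟨p, hp, q, hq, hx⟩ := hx
  exact (h0 hq).elim

end ContactLoci

namespace ContactLoci
variable {K : Type*} [Field K] {ι : Type*} [Fintype ι]

lemma contact_subset [Infinite K] {X A Y : Set (PP K ι)} (hY : IsZClosed Y)
    (h : tangencyLocus X A ⊆ Y) : contactLocus X A ⊆ Y := by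
  refine zclosure_subset hY ?_
  intro y hy
  simp only [Set.mem_iUnion] at hy
  obtain ⟨C, ⟨hC, -⟩, hyC⟩ := hy
  exact h (hC.2.1 hyC)

lemma contact_sub_closure [Infinite K] (X A : Set (PP K ι)) :
    contactLocus X A ⊆ zclosure (tangencyLocus X A) :=
  contact_subset (isZClosed_zclosure _) (subset_zclosure _)

/-- core geometric argument -/
lemma core [IsAlgClosed K] {X : Set (PP K ι)} (hX : IsIntegralVariety X) {n k : ℕ}
    (hn : zdim X = ((n : ℕ∞) : WithBot ℕ∞))
    (hmin : ∀ v ∈ coneOf X, v ≠ 0 → n + 1 ≤ Module.finrank K (TV X v))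
    {u p : Fin k → PP K ι} (hus : ∀ j, IsSmoothPoint X (u j)) (hps : ∀ j, IsSmoothPoint X (p j))
    (hui : IsZIrreducible (contactLocus X (Set.range u)))
    (hpi : IsZIrreducible (contactLocus X (Set.range p)))
    (hfin : Module.finrank K (⨆ j, TV X (p j).rep : Submodule K (ι → K)) =
      Module.finrank K (⨆ j, TV X (u j).rep : Submodule K (ι → K)))
    {W : Set (PP K ι)}
    (hW : IsZIrredComponent (projSpan (contactLocus X (Set.range u)) ∩ X) W)
    (hWt : TangentAlong (projSpan (contactLocus X (Set.range u))) X W)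
    (hp : ∀ j, p j ∈ W ∨ p j ∈ contactLocus X (Set.range u))
    {j1 j2 : Fin k} (hj1 : p j1 ∈ W) (hj2 : p j2 ∈ contactLocus X (Set.range u)) :
    W = contactLocus X (Set.range u) := by
  haveI := IsAlgClosed.instInfinite (K := K)
  obtain ⟨Bad, hBc, hB⟩ := exists_bad hn hmin
  set M : Submodule K (ι → K) := ⨆ j, TV X (u j).rep with hM
  -- general facts
  have hΘX : ∀ A : Set (PP K ι), tangencyLocus X A ⊆ X := fun A x hx => hx.1.1
  have hΓX : ∀ A : Set (PP K ι), contactLocus X A ⊆ X := fun A => contact_subset hX.1 (hΘX A)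
  have htan : ∀ x ∈ contactLocus X (Set.range u), IsSmoothPoint X x → TV X x.rep ≤ M := by
    intro x hx hs
    exact closed_tangency hX.2 hn hmin (hΘX (Set.range u))
      (fun y hy => ((mem_tangencyLocus X u y).1 hy).2) (contact_sub_closure _ _ hx) hs
  have hΓM : contactLocus X (Set.range u) ⊆ PL M := by
    refine contact_subset (isZClosed_PL M) ?_
    intro x hx
    change x.submodule ≤ M
    rw [submodule_le_iff]
    exact ((mem_tangencyLocus X u x).1 hx).2 (self_mem_TV (rep_mem_cone hx.1.1))
  have hspM : vspan (contactLocus X (Set.range u)) ≤ M := by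
    rw [← vspan_PL M]; exact vspan_mono hΓM
  have hWtan : ∀ x ∈ W, IsSmoothPoint X x → TV X x.rep ≤ M := by
    intro x hx hs
    have := hWt x hx hs
    rw [embT_eq, projSpan_eq_PL, PL_le_iff] at this
    exact this.trans hspM
  have hMB : (⨆ j, TV X (p j).rep) = M := by
    refine Submodule.eq_of_le_of_finrank_eq (iSup_le fun j => ?_) hfin
    rcases hp j with h | h
    · exact hWtan _ h (hps j)
    · exact htan _ h (hps j)
  have hΘ : ∀ x, x ∈ tangencyLocus X (Set.range p) ↔ IsSmoothPoint X x ∧ TV X x.rep ≤ M := by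
    intro x; rw [mem_tangencyLocus, hMB]
  have hΘeq : tangencyLocus X (Set.range u) = tangencyLocus X (Set.range p) := by
    ext x; rw [hΘ, mem_tangencyLocus]
  have hΘnb : ∀ A : Set (PP K ι), ∀ x ∈ tangencyLocus X A, x ∉ Bad := fun A x hx =>
    (hB x hx.1.1).2 hx.1
  -- u_j1 lies in Γ
  have huΓ : u j1 ∈ contactLocus X (Set.range u) := by
    obtain ⟨C, hC, hsub⟩ := exists_component (singleton_irred (u j1))
      (S := tangencyLocus X (Set.range u)) (by
        rintro _ rfl
        rw [mem_tangencyLocus]; exact ⟨hus j1, le_iSup (fun j => TV X (u j).rep) j1⟩)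
    exact mem_contact hC ⟨u j1, hsub rfl, Set.mem_range_self _⟩ (hsub rfl)
  obtain ⟨hi1, hc1⟩ := irr_diff hui hBc ⟨u j1, huΓ, (hB _ (hus j1).1).2 (hus j1)⟩
  obtain ⟨C, hC, hsubC⟩ := exists_component hi1 (S := tangencyLocus X (Set.range p)) (by
    rintro x ⟨hx, hxb⟩
    have hs := (hB x (hΓX _ hx)).1 hxb
    exact (hΘ x).2 ⟨hs, htan x hx hs⟩)
  have hCu : C ⊆ contactLocus X (Set.range u) := by
    refine mem_contact (by rw [hΘeq]; exact hC) ⟨u j1, hsubC ⟨huΓ, (hB _ (hus j1).1).2 (hus j1)⟩,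
      Set.mem_range_self _⟩
  have hCp : C ⊆ contactLocus X (Set.range p) :=
    mem_contact hC ⟨p j2, hsubC ⟨hj2, (hB _ (hps j2).1).2 (hps j2)⟩, Set.mem_range_self _⟩
  -- W inside Γ'
  obtain ⟨hi2, hc2⟩ := irr_diff hW.1 hBc ⟨p j1, hj1, (hB _ (hps j1).1).2 (hps j1)⟩
  obtain ⟨C1, hC1, hsubC1⟩ := exists_component hi2 (S := tangencyLocus X (Set.range p)) (by
    rintro x ⟨hx, hxb⟩
    have hs := (hB x (hW.2.1 hx).2).1 hxb
    exact (hΘ x).2 ⟨hs, hWtan x hx hs⟩)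
  have hC1p : C1 ⊆ contactLocus X (Set.range p) :=
    mem_contact hC1 ⟨p j1, hsubC1 ⟨hj1, (hB _ (hps j1).1).2 (hps j1)⟩, Set.mem_range_self _⟩
  have hWp : W ⊆ contactLocus X (Set.range p) :=
    hc2.trans (zclosure_subset (isZClosed_zclosure _) (hsubC1.trans hC1p))
  -- Γ' inside Γ
  have hCd : C ⊆ contactLocus X (Set.range p) \ Bad := fun x hx =>
    ⟨hCp hx, hΘnb _ x (hC.2.1 hx)⟩
  obtain ⟨hi3, hc3⟩ := irr_diff hpi hBc (hC.1.1.mono hCd)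
  have hCeq := hC.2.2 _ hi3 (by
    rintro x ⟨hx, hxb⟩
    have hs := (hB x (hΓX _ hx)).1 hxb
    refine (hΘ x).2 ⟨hs, ?_⟩
    exact closed_tangency hX.2 hn hmin (hΘX (Set.range p))
      (fun y hy => ((hΘ y).1 hy).2) (contact_sub_closure _ _ hx) hs) hCd
  have hpu : contactLocus X (Set.range p) ⊆ contactLocus X (Set.range u) := by
    refine hc3.trans ?_
    rw [← hCeq]
    exact zclosure_subset (isZClosed_zclosure _) hCu
  exact hW.2.2 _ hui (fun x hx => ⟨subset_projSpan _ hx, hΓX _ hx⟩) (hWp.trans hpu)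

lemma zero_case [Infinite K] {X : Set (PP K ι)} (hX : IsIntegralVariety X)
    (hn : zdim X = ((0 : ℕ) : ℕ∞)) {x : PP K ι} (hx : x ∈ X) : X ⊆ zclosure {x} := by
  have h : zdim X ≤ 0 := by rw [hn]; rfl
  rw [zdim, Order.krullDim_nonpos_iff_forall_isMax] at h
  have h1 := h ⟨zclosure {x}, isZClosed_zclosure _, zclosure_irred (singleton_irred x),
    zclosure_mono (by rintro _ rfl; exact hx)⟩
  exact @h1 ⟨X, hX.1, hX.2, subset_zclosure _⟩
    (zclosure_subset hX.1 (by rintro _ rfl; exact hx))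

/-- sum substitution -/
def sumSub (k : ℕ) (G : MvPolynomial ι K) : MvPolynomial (Fin k × ι) K :=
  MvPolynomial.aeval (fun i => ∑ j : Fin k, MvPolynomial.X (j, i)) G

lemma tev_sumSub {k : ℕ} (G : MvPolynomial ι K) (v : Fin k → ι → K) :
    tev v (sumSub k G) = MvPolynomial.eval (∑ j, v j) G := by
  rw [tev, sumSub, eval_sub]
  congr 2
  funext i
  simp

lemma main_pos [IsAlgClosed K] {X : Set (PP K ι)} (hX : IsIntegralVariety X) {m k : ℕ}
    (hk : 1 ≤ k)
    (hn : zdim X = (((m + 1 : ℕ) : ℕ∞) : WithBot ℕ∞))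
    (hsec : ((((k + m) * (m + 1 + 1) - 1 : ℕ) : ℕ∞) : WithBot ℕ∞) ≤ zdim (secant (k + m) X))
    (htypeI : HoldsForGeneralTuples X k fun u =>
      IsZIrreducible (contactLocus X (Set.range u))) :
    HoldsForGeneralTuples X k fun u =>
      ∀ W : Set (PP K ι),
        IsZIrredComponent (projSpan (contactLocus X (Set.range u)) ∩ X) W →
        W ≠ contactLocus X (Set.range u) →
        TangentAlong (projSpan (contactLocus X (Set.range u))) X W →
        ∀ a b : ℕ, 0 < a → a + b = k →
          ¬projSpan (contactLocus X (Set.range u)) ⊆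
            join (secant a W) (secant b (contactLocus X (Set.range u))) := by
  haveI := IsAlgClosed.instInfinite (K := K)
  have hmin := hmin_of_typeI hX.2 hn htypeI
  obtain ⟨F, e, hF, hFu⟩ := exists_F0 hX.2 hn htypeI
  let 𝒢 : Set (MvPolynomial ι K) := {G | ∀ B : Fin k → ι → K, (∀ j, B j ∈ coneOf X) →
    tev B F = 0 → MvPolynomial.eval (∑ j, B j) G = 0}
  refine ⟨multiZeroLocus ((fun G => F * sumSub k G) '' 𝒢), isMultiZClosed_locus _, ?_, ?_⟩
  · obtain ⟨v, hv, G, hG, hne⟩ := key_sum hX.2 k m (m + 1) (by nlinarith) (tI_of_zdim hX hn)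
      hsec F hF
    have hG' : sumSub k G ∉ IXm X k := not_mem_IXm.2 ⟨v, hv, by rw [tev_sumSub]; exact hne⟩
    have hprod : F * sumSub k G ∉ IXm X k := fun h =>
      ((IXm_prime hX.2 k).mem_or_mem h).elim hF hG'
    obtain ⟨v', hv', hne'⟩ := not_mem_IXm.1 hprod
    obtain ⟨u, huX, huv⟩ := choose_points hv'
    exact ⟨u, huX, fun hu => hne' (hu _ ⟨G, hG, rfl⟩ v' huv)⟩
  · intro u huX huT W hW hWne hWt a b ha hab hcov
    have : ∃ G ∈ 𝒢, ∃ v : Fin k → ι → K, (∀ i, v i ∈ (u i).submodule) ∧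
        tev v (F * sumSub k G) ≠ 0 := by
      by_contra h
      push Not at h
      refine huT ?_
      rintro _ ⟨G, hG, rfl⟩ v hv
      exact h G hG v hv
    obtain ⟨G, hG, v, huv, hne⟩ := this
    rw [tev, map_mul] at hne
    have hFv := left_ne_zero_of_mul hne
    have hGv : MvPolynomial.eval (∑ j, v j) G ≠ 0 := by
      rw [← tev_sumSub]; exact right_ne_zero_of_mul hne
    obtain ⟨hv0, hus, hui, hue⟩ := hFu u v huX huv hFv
    have huΓ : ∀ j, u j ∈ contactLocus X (Set.range u) := by
      intro j
      obtain ⟨C, hC, hsub⟩ := exists_component (singleton_irred (u j))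
        (S := tangencyLocus X (Set.range u)) (by
          rintro _ rfl
          rw [mem_tangencyLocus]; exact ⟨hus j, le_iSup (fun j => TV X (u j).rep) j⟩)
      exact mem_contact hC ⟨u j, hsub rfl, Set.mem_range_self _⟩ (hsub rfl)
    rcases Nat.eq_zero_or_pos b with hb | hb
    · subst hb
      exact (join_zero _ _ (hcov (subset_projSpan _ (huΓ ⟨0, hk⟩)))).elim
    have hΓX : contactLocus X (Set.range u) ⊆ X := contact_subset hX.1 fun x hx => hx.1.1
    have hsum0 : ∑ j, v j ≠ 0 := by
      intro h0
      have hF0 : tev (fun _ : Fin k => (0 : ι → K)) F = 0 := by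
        by_contra h
        exact (hFu u (fun _ => 0) huX (fun i => Submodule.zero_mem _) h).1 ⟨0, hk⟩ rfl
      have := hG (fun _ => 0) (fun _ => zero_mem_cone hX.2.1) hF0
      rw [Finset.sum_const_zero] at this
      rw [h0] at hGv
      exact hGv this
    have hq : (Projectivization.mk K (∑ j, v j) hsum0 : PP K ι) ∈
        projSpan (contactLocus X (Set.range u)) := by
      change (Projectivization.mk K (∑ j, v j) hsum0 : PP K ι).submodule ≤
        vspan (contactLocus X (Set.range u))
      rw [Projectivization.submodule_mk, Submodule.span_singleton_le_iff_mem]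
      exact Submodule.sum_mem _ fun j _ => Submodule.subset_span
        (mem_coneOf.2 ⟨u j, huΓ j, huv j⟩)
    have hex : ∃ (w : Fin a → ι → K) (y : Fin b → ι → K), (∀ j, w j ∈ coneOf W) ∧
        (∀ j, y j ∈ coneOf (contactLocus X (Set.range u))) ∧
        ∃ f ∈ 𝒢, MvPolynomial.eval (∑ j, w j + ∑ j, y j) f ≠ 0 := by
      by_contra h
      push Not at h
      exact hGv (join_subset 𝒢 h (hcov hq) G hG _ (mem_mk_submodule hsum0))
    obtain ⟨w, y, hw, hy, f, hf, hfne⟩ := hex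
    obtain ⟨pw, hpW, hpw⟩ := choose_points hw
    obtain ⟨py, hpY, hpy⟩ := choose_points hy
    subst hab
    let p : Fin (a + b) → PP K ι := Fin.append pw py
    let B : Fin (a + b) → ι → K := Fin.append w y
    have hp : ∀ j, p j ∈ W ∨ p j ∈ contactLocus X (Set.range u) := by
      intro j
      refine Fin.addCases (fun i => ?_) (fun i => ?_) j
      · left; simpa [p] using hpW i
      · right; simpa [p] using hpY i
    have hpX : ∀ j, p j ∈ X := fun j => (hp j).elim (fun h => (hW.2.1 h).2) (fun h => hΓX h)
    have hpB : ∀ j, B j ∈ (p j).submodule := by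
      intro j
      refine Fin.addCases (fun i => ?_) (fun i => ?_) j
      · simpa [p, B] using hpw i
      · simpa [p, B] using hpy i
    have hBF : tev B F ≠ 0 := by
      intro h0
      apply hfne
      have := hf B (fun j => mem_coneOf.2 ⟨p j, hpX j, hpB j⟩) h0
      rw [Fin.sum_univ_add] at this
      simpa [B] using this
    obtain ⟨-, hps, hpi, hpe⟩ := hFu p B hpX hpB hBF
    refine hWne (core hX hn hmin hus hps hui hpi (hpe.trans hue.symm) hW hWt hp
      (j1 := Fin.castAdd b ⟨0, ha⟩) (j2 := Fin.natAdd a ⟨0, hb⟩) ?_ ?_)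
    · rw [show p (Fin.castAdd b ⟨0, ha⟩) = pw ⟨0, ha⟩ from Fin.append_left _ _ _]
      exact hpW _
    · rw [show p (Fin.natAdd a ⟨0, hb⟩) = py ⟨0, hb⟩ from Fin.append_right _ _ _]
      exact hpY _

/-- **Proposition (type I obstruction).**  Let `X ⊆ ℙ^r` be an integral
non-degenerate variety of dimension `n` (char `0`), weakly `k`-defective, with
`dim σ_{k+n-1}(X) = (k+n-1)(n+1) - 1 < r`, whose general tangential `k`-contact locus
`Γ_k` is irreducible (type I).  If `W` is an irreducible component of `Π_k ∩ X`
(`Π_k = ⟨Γ_k⟩`) different from `Γ_k` such that `Π_k` is tangent to `X` along `W`,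
then for all `a > 0`, `b ≥ 0` with `a + b = k`, the join of `σ_a(W)` and `σ_b(Γ_k)`
cannot cover `Π_k`. -/
theorem statement5 {K : Type*} [Field K] [IsAlgClosed K] [CharZero K]
    {ι : Type*} [Fintype ι] (r n k : ℕ) (hι : Fintype.card ι = r + 1)
    (X : Set (PP K ι)) (hX : IsIntegralVariety X) (hXnd : Nondegenerate X)
    (hXdim : zdim X = ((n : ℕ∞) : WithBot ℕ∞)) (hk : 1 ≤ k)
    (hwd : WeaklyDefective X k)
    (hsec : zdim (secant (k + n - 1) X) =
      ((((k + n - 1) * (n + 1) - 1 : ℕ) : ℕ∞) : WithBot ℕ∞))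
    (hlt : (k + n - 1) * (n + 1) - 1 < r)
    (htypeI : HoldsForGeneralTuples X k fun u =>
      IsZIrreducible (contactLocus X (Set.range u))) :
    HoldsForGeneralTuples X k fun u =>
      ∀ W : Set (PP K ι),
        IsZIrredComponent (projSpan (contactLocus X (Set.range u)) ∩ X) W →
        W ≠ contactLocus X (Set.range u) →
        TangentAlong (projSpan (contactLocus X (Set.range u))) X W →
        ∀ a b : ℕ, 0 < a → a + b = k →
          ¬projSpan (contactLocus X (Set.range u)) ⊆
            join (secant a W) (secant b (contactLocus X (Set.range u))) := by
  haveI := IsAlgClosed.instInfinite (K := K)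
  rcases n with _ | m
  · obtain ⟨T, hT, hne, hP⟩ := htypeI
    refine ⟨T, hT, hne, fun u huX huT W hW hWne => ?_⟩
    have hui := hP u huX huT
    have hΓX : contactLocus X (Set.range u) ⊆ X := contact_subset hX.1 fun x hx => hx.1.1
    obtain ⟨x, hx⟩ := hui.1
    have hXΓ : X ⊆ contactLocus X (Set.range u) :=
      (zero_case hX hXdim (hΓX hx)).trans
        (zclosure_subset (isZClosed_zclosure _) (by rintro _ rfl; exact hx))
    exact absurd (hW.2.2 _ hui (fun x hx => ⟨subset_projSpan _ hx, hΓX hx⟩)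
      (fun y hy => hXΓ (hW.2.1 hy).2)) hWne
  · exact main_pos hX hk hXdim (le_of_eq hsec.symm) htypeI

end ContactLoci
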